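/- arXiv:math/0611080 — 2 statements merged into one kernel-verified Lean document; each statement's English description precedes it below -/
import Mathlib

section
/- Let g, h : ℝ → ℝ be smooth (C^∞) 2π-periodic functions with g(x) < h(x) for all x, and let Λ_g, Λ_h be the Legendrian knots Λ_g(x) = (x, g'(x), g(x)) and Λ_h(x) = (x, h'(x), h(x)). Then there is NO Legendrian isotopy of ordered Legendrian links from (Λ_g, Λ_h) to (Λ_h, Λ_g); that is, there do not exist smooth maps H⁰, H¹ : ℝ × ℝ → ℝ³ such that for each t ∈ [0,1] the pair (H⁰(t,·), H¹(t,·)) is an ordered Legendrian link, (H⁰(0,·), H¹(0,·)) = (Λ_g, Λ_h), the image of H⁰(1,·) equals the image of Λ_h, and the image of H¹(1,·) equals the image of Λ_g. -/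
open Real

/-- A spinning loop: smooth map ℝ → ℝ³ equivariant under the deck
transformation (translation by 2π in the x-coordinate). -/
def SpinningLoop (γ : ℝ → ℝ × ℝ × ℝ) : Prop :=
  ContDiff ℝ (⊤ : ℕ∞) γ ∧ ∀ x, γ (x + 2 * π) = γ x + (2 * π, 0, 0)

/-- An embedded spinning loop: an immersion, injective modulo the deck action. -/
def EmbeddedSpinningLoop (γ : ℝ → ℝ × ℝ × ℝ) : Prop :=
  SpinningLoop γ ∧ (∀ x, deriv γ x ≠ 0) ∧
    ∀ x x', γ x = γ x' → ∃ k : ℤ, x - x' = 2 * π * k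

/-- A Legendrian knot: an embedded spinning loop tangent to ker(dz - y dx). -/
def LegendrianKnot (γ : ℝ → ℝ × ℝ × ℝ) : Prop :=
  EmbeddedSpinningLoop γ ∧
    ∀ x, deriv (fun s => (γ s).2.2) x = (γ x).2.1 * deriv (fun s => (γ s).1) x

/-- An ordered Legendrian link: two Legendrian knots with disjoint images. -/
def OrderedLegendrianLink (L₀ L₁ : ℝ → ℝ × ℝ × ℝ) : Prop :=
  LegendrianKnot L₀ ∧ LegendrianKnot L₁ ∧ Disjoint (Set.range L₀) (Set.range L₁)

section Brouwer

open MeasureTheory Metric Set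

variable {E : Type*} [NormedAddCommGroup E] [InnerProductSpace ℝ E] [FiniteDimensional ℝ E]

/-- The polynomial `t ↦ det (1 + t A)` is recovered by interpolation from `finrank + 1` nodes. -/
lemma det_one_add_smul_eq_sum_basis (A : E →L[ℝ] E) (v : ℕ → ℝ) (hv : Function.Injective v)
    (t : ℝ) :
    (1 + t • A).det = ∑ i ∈ Finset.range (Module.finrank ℝ E + 1), (1 + v i • A).det *
      (Lagrange.basis (Finset.range (Module.finrank ℝ E + 1)) v i).eval t := by
  set b := Module.finBasis ℝ E
  set M := LinearMap.toMatrix b b (A : E →ₗ[ℝ] E)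
  set p : Polynomial ℝ :=
    ((Polynomial.X : Polynomial ℝ) • M.map ⇑(Polynomial.C : ℝ →+* Polynomial ℝ) +
      (1 : Matrix (Fin (Module.finrank ℝ E)) (Fin (Module.finrank ℝ E)) ℝ).map ⇑Polynomial.C).det
  have hp : ∀ s : ℝ, p.eval s = (1 + s • A).det := by
    intro s
    have h1 : (1 + s • A).det = (1 + s • M).det := by
      rw [ContinuousLinearMap.det, ← LinearMap.det_toMatrix b]
      congr 1
      have : ((1 + s • A : E →L[ℝ] E) : E →ₗ[ℝ] E) = LinearMap.id + s • (A : E →ₗ[ℝ] E) := by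
        ext; simp
      rw [this, map_add, map_smul, LinearMap.toMatrix_id]
    rw [h1]
    change Polynomial.evalRingHom s p = _
    rw [RingHom.map_det]
    congr 1
    ext i j
    by_cases hij : i = j
    · subst hij; simp [add_comm, mul_comm s]
    · simp [hij, mul_comm s]
  have hdeg : p.degree < ((Finset.range (Module.finrank ℝ E + 1)).card : ℕ) := by
    refine Polynomial.degree_le_natDegree.trans_lt ?_
    have := Polynomial.natDegree_det_X_add_C_le M 1
    rw [Fintype.card_fin] at this
    rw [Finset.card_range]
    exact_mod_cast Nat.lt_succ_of_le this
  have := Lagrange.eq_interpolate (f := p) (s := Finset.range (Module.finrank ℝ E + 1)) (v := v)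
    hv.injOn hdeg
  rw [← hp t]
  conv_lhs => rw [this, Lagrange.interpolate_apply, Polynomial.eval_finsetSum]
  simp [hp]

/-- There is no `C¹` retraction of the unit ball onto the unit sphere. -/
lemma no_retraction_onto_sphere (r : E → E) (hr : ContDiff ℝ 1 r) (hnorm : ∀ x, ‖r x‖ = 1)
    (hfix : ∀ x, ‖x‖ = 1 → r x = x) : False := by
  borelize E
  set ψ : E → E := fun x => r x - x
  have hψ : ContDiff ℝ 1 ψ := hr.sub contDiff_id
  have hψd : Differentiable ℝ ψ := hψ.differentiable one_ne_zero
  have hcont : Continuous (fderiv ℝ ψ) := hψ.continuous_fderiv one_ne_zero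
  obtain ⟨L, hL⟩ : ∃ L, ∀ x ∈ closedBall (0 : E) 1, ‖fderiv ℝ ψ x‖ ≤ L :=
    (isCompact_closedBall (0 : E) 1).exists_bound_of_continuousOn hcont.continuousOn
  have hL0 : 0 ≤ L := (norm_nonneg _).trans (hL 0 (by simp))
  have hlip : ∀ x ∈ closedBall (0 : E) 1, ∀ y ∈ closedBall (0 : E) 1,
      ‖ψ y - ψ x‖ ≤ L * ‖y - x‖ := fun x hx y hy =>
    (convex_closedBall (0 : E) 1).norm_image_sub_le_of_norm_fderiv_le
      (fun x _ => hψd x) hL hx hy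
  obtain ⟨δ, hδ, hdet⟩ : ∃ δ > 0, ∀ B : E →L[ℝ] E, ‖B‖ < δ → 0 < (1 + B).det := by
    have hc : Continuous fun B : E →L[ℝ] E => (1 + B).det :=
      ContinuousLinearMap.continuous_det.comp (by fun_prop)
    have h1 : (0 : ℝ) < (1 + (0 : E →L[ℝ] E)).det := by
      simp [ContinuousLinearMap.det]
    obtain ⟨δ, hδ, h⟩ := Metric.eventually_nhds_iff.1 (hc.continuousAt.eventually (lt_mem_nhds h1))
    exact ⟨δ, hδ, fun B hB => h (by simpa using hB)⟩
  set U := ball (0 : E) 1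
  set F : ℝ → E → E := fun t x => x + t • ψ x
  have hFd : ∀ t x, HasStrictFDerivAt (F t) (1 + t • fderiv ℝ ψ x) x := fun t x =>
    (hasStrictFDerivAt_id x).add
      (((hψ.contDiffAt.hasStrictFDerivAt one_ne_zero)).const_smul t)
  obtain ⟨η, hη, hη1, hηL, hηδ⟩ : ∃ η > 0, η < 1 ∧ η * L < 1 ∧ η * L < δ := by
    refine ⟨min 1 δ / (2 * (L + 1)), by positivity, ?_, ?_, ?_⟩
    · rw [div_lt_one (by positivity)]; nlinarith [min_le_left 1 δ]
    · rw [div_mul_eq_mul_div, div_lt_one (by positivity)]; nlinarith [min_le_left 1 δ]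
    · rw [div_mul_eq_mul_div, div_lt_iff₀ (by positivity)]; nlinarith [min_le_right 1 δ]
  have hsmall : ∀ t, 0 ≤ t → t ≤ η → ∫ x in U, (1 + t • fderiv ℝ ψ x).det = volume.real U := by
    intro t ht0 htη
    have htL : t * L ≤ η * L := by gcongr
    have hpos : ∀ x ∈ U, 0 < (1 + t • fderiv ℝ ψ x).det := by
      intro x hx
      apply hdet
      rw [norm_smul, Real.norm_of_nonneg ht0]
      have := hL x (ball_subset_closedBall hx)
      calc t * ‖fderiv ℝ ψ x‖ ≤ t * L := by gcongr
        _ < δ := by linarith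
    have hinj : InjOn (F t) (closedBall 0 1) := by
      intro x hx y hy hxy
      have h1 : y - x = t • (ψ x - ψ y) := by
        have : x + t • ψ x = y + t • ψ y := hxy
        rw [smul_sub, sub_eq_sub_iff_add_eq_add, ← this]; abel
      have h2 : ‖y - x‖ ≤ t * L * ‖y - x‖ := by
        calc ‖y - x‖ = t * ‖ψ y - ψ x‖ := by
              rw [norm_sub_rev (ψ y)]; conv_lhs => rw [h1]
              rw [norm_smul, Real.norm_of_nonneg ht0]
          _ ≤ t * (L * ‖y - x‖) := by gcongr; exact hlip x hx y hy
          _ = _ := by ring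
      by_contra hne
      have : 0 < ‖y - x‖ := norm_pos_iff.2 (sub_ne_zero.2 (Ne.symm hne))
      nlinarith
    have hmaps : ∀ x ∈ U, F t x ∈ U := by
      intro x hx
      have hx' : ‖x‖ < 1 := by simpa [U] using hx
      have : F t x = (1 - t) • x + t • r x := by simp only [F, ψ]; module
      have : ‖F t x‖ ≤ (1 - t) * ‖x‖ + t := by
        rw [this]
        refine (norm_add_le _ _).trans ?_
        rw [norm_smul, norm_smul, hnorm, Real.norm_of_nonneg ht0,
          Real.norm_of_nonneg (by linarith : (0:ℝ) ≤ 1 - t), mul_one]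
      simp only [U, mem_ball_zero_iff]
      nlinarith
    have hopen : IsOpen (F t '' U) := by
      rw [isOpen_iff_mem_nhds]
      rintro _ ⟨x, hx, rfl⟩
      have hsurj : ((1 + t • fderiv ℝ ψ x : E →L[ℝ] E) : E →ₗ[ℝ] E).range = ⊤ := by
        have hu : IsUnit (LinearMap.det ((1 + t • fderiv ℝ ψ x : E →L[ℝ] E) : E →ₗ[ℝ] E)) :=
          (hpos x hx).ne'.isUnit
        exact LinearMap.range_eq_top.2 ((LinearMap.isUnit_iff_isUnit_det _).2 hu
          |> (Module.End.isUnit_iff _).1).2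
      rw [← (hFd t x).map_nhds_eq_of_surj hsurj]
      exact Filter.image_mem_map (isOpen_ball.mem_nhds hx)
    have himg : F t '' U = U := by
      apply Subset.antisymm (by rintro _ ⟨x, hx, rfl⟩; exact hmaps x hx)
      refine (convex_ball (0 : E) 1).isPreconnected.subset_of_closure_inter_subset hopen
        ⟨F t 0, hmaps 0 (by simp [U]), mem_image_of_mem _ (by simp [U])⟩ ?_
      rintro y ⟨hy, hyU⟩
      have hcl : IsClosed (F t '' closedBall 0 1) := by
        have : Continuous (F t) := by
          have := hψ.continuous
          fun_prop
        exact ((isCompact_closedBall (0 : E) 1).image this).isClosed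
      obtain ⟨x, hx, rfl⟩ :=
        closure_minimal (image_mono ball_subset_closedBall) hcl hy
      refine ⟨x, ?_, rfl⟩
      by_contra hxU
      have hx1 : ‖x‖ = 1 := by
        simp only [U, mem_ball_zero_iff, not_lt, mem_closedBall_zero_iff] at hx hxU
        exact le_antisymm hx hxU
      have : F t x = x := by simp [F, ψ, hfix x hx1]
      rw [this] at hyU
      exact hxU hyU
    have hcv := integral_image_eq_integral_abs_det_fderiv_smul (volume : Measure E)
      (s := U) (f := F t) (f' := fun x => 1 + t • fderiv ℝ ψ x) measurableSet_ball
      (fun x _ => (hFd t x).hasFDerivAt.hasFDerivWithinAt)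
      (hinj.mono ball_subset_closedBall) (fun _ => (1 : ℝ))
    rw [himg] at hcv
    rw [setIntegral_congr_fun measurableSet_ball
      (g := fun x => |(1 + t • fderiv ℝ ψ x).det| • (1 : ℝ))
      (fun x hx => by simp [abs_of_pos (hpos x hx)]), ← hcv]
    simp
  set n := Module.finrank ℝ E
  set v : ℕ → ℝ := fun i => η / (i + 1)
  have hvinj : Function.Injective v := by
    intro i j hij
    simp only [v] at hij
    have hi : (0 : ℝ) < i + 1 := by positivity
    have hj : (0 : ℝ) < j + 1 := by positivity
    rw [div_eq_div_iff hi.ne' hj.ne'] at hij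
    have := mul_left_cancel₀ hη.ne' hij
    exact_mod_cast (add_right_cancel this).symm
  have hvle : ∀ i, v i ≤ η := fun i => div_le_self hη.le (by simp)
  have hv0 : ∀ i, 0 ≤ v i := fun i => by positivity
  have hintegrable : ∀ t : ℝ, IntegrableOn (fun x => (1 + t • fderiv ℝ ψ x).det) U := by
    intro t
    have : Continuous fun x => (1 + t • fderiv ℝ ψ x).det :=
      ContinuousLinearMap.continuous_det.comp (by fun_prop)
    exact (this.continuousOn.integrableOn_compact (isCompact_closedBall (0 : E) 1)).mono_set
      ball_subset_closedBall
  have hone : ∫ x in U, (1 + (1 : ℝ) • fderiv ℝ ψ x).det = volume.real U := by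
    have h1 : ∀ x, (1 + (1 : ℝ) • fderiv ℝ ψ x).det = _ := fun x =>
      det_one_add_smul_eq_sum_basis (fderiv ℝ ψ x) v hvinj 1
    simp_rw [h1]
    rw [integral_finsetSum _ (fun i _ => ((hintegrable (v i)).mul_const _))]
    simp_rw [integral_mul_const, hsmall _ (hv0 _) (hvle _)]
    rw [← Finset.mul_sum, ← Polynomial.eval_finsetSum,
      Lagrange.sum_basis hvinj.injOn (by simp)]
    simp
  have hzero : ∀ x, (1 + (1 : ℝ) • fderiv ℝ ψ x).det = 0 := by
    intro x
    have hrd := hr.differentiable one_ne_zero x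
    have h1 : (1 + (1 : ℝ) • fderiv ℝ ψ x) = fderiv ℝ r x := by
      have : fderiv ℝ ψ x = fderiv ℝ r x - ContinuousLinearMap.id ℝ E := by
        exact (hrd.hasFDerivAt.sub (hasFDerivAt_id x)).fderiv
      rw [this]; ext; simp
    rw [h1]
    by_contra hne
    have hu : IsUnit (LinearMap.det (fderiv ℝ r x : E →ₗ[ℝ] E)) := Ne.isUnit hne
    have hsurj := ((LinearMap.isUnit_iff_isUnit_det _).2 hu |> (Module.End.isUnit_iff _).1).2
    obtain ⟨w, hw⟩ := hsurj (r x)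
    have hd : HasFDerivAt (fun y => inner ℝ (r y) (r y)) _ x :=
      hrd.hasFDerivAt.inner ℝ hrd.hasFDerivAt
    have hc : (fun y => inner ℝ (r y) (r y)) = fun _ => (1 : ℝ) := by
      funext y; rw [real_inner_self_eq_norm_sq, hnorm]; norm_num
    rw [hc] at hd
    have := congrArg (fun A : E →L[ℝ] ℝ => A w) (hd.unique (hasFDerivAt_const 1 x))
    have hw' : (fderiv ℝ r x) w = r x := hw
    simp [fderivInnerCLM_apply, hw', hnorm] at this
  simp_rw [hzero] at hone
  have hU : 0 < volume.real U :=
    ENNReal.toReal_pos (measure_ball_pos _ _ one_pos).ne' measure_ball_lt_top.ne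
  simp at hone
  linarith

/-- A `C¹` bounded perturbation of the identity has a zero. -/
lemma exists_add_eq_zero_of_bounded (β : E → E) (hβ : ContDiff ℝ 1 β) (C : ℝ)
    (hC : ∀ x, ‖β x‖ ≤ C) : ∃ x, x + β x = 0 := by
  by_contra! hne
  have hC0 : 0 ≤ C := (norm_nonneg _).trans (hC 0)
  let χ : ContDiffBump (0 : E) := ⟨C + 1, C + 2, by linarith, by linarith⟩
  set G : E → E := fun x => x + χ x • β x
  have hG : ContDiff ℝ 1 G := contDiff_id.add (χ.contDiff.smul hβ)
  have hG0 : ∀ x, G x ≠ 0 := by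
    intro x hx
    by_cases hxC : ‖x‖ ≤ C + 1
    · have : χ x = 1 := χ.one_of_mem_closedBall (by simpa using hxC)
      simp only [G, this, one_smul] at hx
      exact hne x hx
    · have h1 : ‖x‖ = ‖χ x • β x‖ := by
        rw [← norm_neg (χ x • β x), ← eq_neg_of_add_eq_zero_left hx]
      have h2 : ‖χ x • β x‖ ≤ 1 * C := by
        rw [norm_smul, Real.norm_of_nonneg χ.nonneg]
        exact mul_le_mul χ.le_one (hC x) (norm_nonneg _) zero_le_one
      linarith [not_le.1 hxC]
  have hR : (0 : ℝ) < C + 2 := by linarith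
  set r : E → E := fun x => ‖G ((C + 2) • x)‖⁻¹ • G ((C + 2) • x)
  have hGs : ContDiff ℝ 1 fun x : E => G ((C + 2) • x) := hG.comp (contDiff_const_smul _)
  refine no_retraction_onto_sphere r ?_ ?_ ?_
  · exact ((hGs.norm ℝ (fun x => hG0 _)).inv (fun x => norm_ne_zero_iff.2 (hG0 _))).smul hGs
  · intro x
    simp only [r, norm_smul, norm_inv, norm_norm]
    exact inv_mul_cancel₀ (norm_ne_zero_iff.2 (hG0 _))
  · intro x hx
    have hnx : ‖(C + 2) • x‖ = C + 2 := by rw [norm_smul, hx, Real.norm_of_nonneg hR.le, mul_one]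
    have : χ ((C + 2) • x) = 0 := χ.zero_of_le_dist (by simp [hnx, χ])
    simp only [r, G, this, zero_smul, add_zero, hnx]
    rw [smul_smul, inv_mul_cancel₀ hR.ne', one_smul]

end Brouwer

/-- Iterates of the steps `x ↦ x - η U k x`. -/
def descentIterate {E : Type*} [NormedAddCommGroup E] [InnerProductSpace ℝ E] (η : ℝ)
    (U : ℕ → E → E) (p : E) : ℕ → E
  | 0 => p
  | k + 1 => descentIterate η U p k - η • U k (descentIterate η U p k)

lemma contDiff_descentIterate {E : Type*} [NormedAddCommGroup E] [InnerProductSpace ℝ E]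
    {η : ℝ} {U : ℕ → E → E} (hU : ∀ k, ContDiff ℝ 1 (U k)) (k : ℕ) :
    ContDiff ℝ 1 fun p => descentIterate η U p k := by
  induction k with
  | zero => exact contDiff_id
  | succ k ih => exact ih.sub (((hU k).comp ih).const_smul η)

/-- Along enough steps of a discrete descent in a bounded region, one step is almost critical. -/
lemma exists_almost_critical_of_descent {E : Type*} [NormedAddCommGroup E]
    [InnerProductSpace ℝ E] {S : E → ℝ} {V : E → E} {c ρ L η δ D : ℝ} {T : ℕ}
    (hV : ∀ x, c * ‖V x‖ ^ 2 ≤ fderiv ℝ S x (V x))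
    (hL : ∀ x ∈ Metric.closedBall (0 : E) ρ, ∀ y ∈ Metric.closedBall (0 : E) ρ,
      S y ≤ S x + fderiv ℝ S x (y - x) + L * ‖y - x‖ ^ 2)
    (hc : 0 < c) (hη : 0 < η) (hηL : L * η ≤ c / 2) (hδ : 0 < δ)
    (hD : ∀ x ∈ Metric.closedBall (0 : E) ρ, |S x| ≤ D) (hT : 2 * D < T * (η * c / 2 * δ ^ 2))
    (ξ : ℕ → E) (hξ : ∀ k ≤ T, ξ k ∈ Metric.closedBall (0 : E) ρ)
    (hstep : ∀ k < T, ξ (k + 1) = ξ k - η • V (ξ k)) :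
    ∃ k < T, ‖V (ξ k)‖ ≤ δ ∧ S (ξ T) ≤ S (ξ k) ∧ S (ξ k) ≤ S (ξ 0) := by
  have hdec : ∀ k < T, S (ξ (k + 1)) ≤ S (ξ k) - η * c / 2 * ‖V (ξ k)‖ ^ 2 := by
    intro k hk
    have h := hL _ (hξ k hk.le) _ (hξ (k + 1) hk)
    have he : ξ (k + 1) - ξ k = -(η • V (ξ k)) := by rw [hstep k hk]; abel
    rw [he, map_neg, map_smul, norm_neg, norm_smul, Real.norm_of_nonneg hη.le, smul_eq_mul] at h
    have h1 := mul_le_mul_of_nonneg_left (hV (ξ k)) hη.le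
    have h2 : L * η * (η * ‖V (ξ k)‖ ^ 2) ≤ c / 2 * (η * ‖V (ξ k)‖ ^ 2) := by gcongr
    nlinarith
  have hanti : ∀ k < T, S (ξ (k + 1)) ≤ S (ξ k) := fun k hk =>
    (hdec k hk).trans (sub_le_self _ (by positivity))
  have hto : ∀ j k, k + j ≤ T → S (ξ (k + j)) ≤ S (ξ k) := by
    intro j
    induction j with
    | zero => intro k _; simp
    | succ j ih => intro k hk; exact (hanti (k + j) (by omega)).trans (ih k (by omega))
  have hex : ∃ k < T, ‖V (ξ k)‖ ≤ δ := by
    by_contra! hbig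
    have hind : ∀ k ≤ T, S (ξ k) ≤ S (ξ 0) - k * (η * c / 2 * δ ^ 2) := by
      intro k
      induction k with
      | zero => simp
      | succ k ih =>
        intro hk
        have h1 := ih (by omega)
        have h2 := hdec k hk
        have h3 : δ ^ 2 ≤ ‖V (ξ k)‖ ^ 2 := pow_le_pow_left₀ hδ.le (hbig k hk).le 2
        have h4 : η * c / 2 * δ ^ 2 ≤ η * c / 2 * ‖V (ξ k)‖ ^ 2 := by gcongr
        push_cast
        linarith
    have h1 := hind T le_rfl
    have h2 := abs_le.1 (hD _ (hξ T le_rfl))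
    have h3 := abs_le.1 (hD _ (hξ 0 (Nat.zero_le _)))
    linarith
  obtain ⟨k, hk, hVk⟩ := hex
  refine ⟨k, hk, hVk, ?_, ?_⟩
  · have := hto (T - k) k (by omega)
    rwa [Nat.add_sub_cancel' hk.le] at this
  · simpa using hto k 0 (by omega)

section Minimax

open Metric Set

variable {E : Type*} [NormedAddCommGroup E] [InnerProductSpace ℝ E] [FiniteDimensional ℝ E]

lemma exists_taylor_upper_bound {S : E → ℝ} (hS : ContDiff ℝ 2 S) (ρ : ℝ) :
    ∃ L, 0 ≤ L ∧ ∀ x ∈ closedBall (0 : E) ρ, ∀ y ∈ closedBall (0 : E) ρ,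
      S y ≤ S x + fderiv ℝ S x (y - x) + L * ‖y - x‖ ^ 2 := by
  have hd : ContDiff ℝ 1 (fderiv ℝ S) := hS.fderiv_right (by norm_num)
  obtain ⟨L, hL⟩ := (isCompact_closedBall (0 : E) ρ).exists_bound_of_continuousOn
    (hd.continuous_fderiv one_ne_zero).continuousOn
  have hlip : ∀ x ∈ closedBall (0 : E) ρ, ∀ y ∈ closedBall (0 : E) ρ,
      ‖fderiv ℝ S y - fderiv ℝ S x‖ ≤ L * ‖y - x‖ := fun x hx y hy =>
    (convex_closedBall (0 : E) ρ).norm_image_sub_le_of_norm_fderiv_le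
      (fun x _ => hd.differentiable one_ne_zero x) hL hx hy
  refine ⟨max L 0, le_max_right _ _, fun x hx y hy => ?_⟩
  have hmain := ((convex_closedBall (0 : E) ρ).inter
    (convex_closedBall x ‖y - x‖)).norm_image_sub_le_of_norm_fderiv_le'
    (f := S) (𝕜 := ℝ) (C := max L 0 * ‖y - x‖) (φ := fderiv ℝ S x) (x := x) (y := y)
    (fun z _ => hS.differentiable two_ne_zero z) (fun z hz => by
      refine (hlip x hx z hz.1).trans ?_
      have : ‖z - x‖ ≤ ‖y - x‖ := by simpa [dist_eq_norm] using hz.2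
      exact mul_le_mul (le_max_left _ _) this (norm_nonneg _) (le_max_right _ _))
    ⟨hx, by simp⟩ ⟨hy, by simp [dist_eq_norm]⟩
  have := (abs_le.1 ((Real.norm_eq_abs _).symm.trans_le hmain)).2
  nlinarith

/-- Shooting: a descent for vector fields at bounded distance from a hyperbolic linear one has an
orbit, of any prescribed length, which stays in a region not depending on the length. -/
lemma exists_bounded_descentIterate {n : ℕ} (b : OrthonormalBasis (Fin n) ℝ E) {μ : Fin n → ℝ}
    {m M C η : ℝ} (hm : 0 < m) (hμ : ∀ i, m ≤ |μ i|) (hM : ∀ i, |μ i| ≤ M) (hη : 0 < η)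
    (hηM : η * M ≤ 1) (hC : 0 ≤ C) {U : ℕ → E → E} (hU : ∀ k, ContDiff ℝ 1 (U k))
    (hUC : ∀ k x i, |b.repr (U k x) i - μ i * b.repr x i| ≤ C) (K : ℕ) :
    ∃ p, ∀ k ≤ K, ‖descentIterate η U p k‖ ≤ n * (C / m) := by
  set R := C / m
  have hR : 0 ≤ R := by positivity
  have hRm : ∀ i, C ≤ R * |μ i| := fun i =>
    calc C = R * m := by simp only [R]; field_simp
      _ ≤ R * |μ i| := by gcongr; exact hμ i
  have hnorm : ∀ x : E, (∀ i, |b.repr x i| ≤ R) → ‖x‖ ≤ n * R := by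
    intro x hx
    calc ‖x‖ = ‖∑ i, b.repr x i • b i‖ := by rw [b.sum_repr]
      _ ≤ ∑ i, ‖b.repr x i • b i‖ := norm_sum_le _ _
      _ ≤ ∑ _i : Fin n, R := by
        gcongr with i
        rw [norm_smul, b.norm_eq_one, mul_one]
        exact hx i
      _ = n * R := by simp
  have hstep : ∀ p k i, ∃ e, |e| ≤ C ∧ b.repr (descentIterate η U p (k + 1)) i =
      (1 - η * μ i) * b.repr (descentIterate η U p k) i - η * e := by
    intro p k i
    refine ⟨_, hUC k (descentIterate η U p k) i, ?_⟩
    simp only [descentIterate, map_sub, map_smul, PiLp.sub_apply, PiLp.smul_apply, smul_eq_mul]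
    ring
  set d : Fin n → E → ℝ := fun i p =>
    if 0 < μ i then 0 else ((1 - η * μ i) ^ K)⁻¹ * b.repr (descentIterate η U p K) i - b.repr p i
  have hd : ∀ i, ContDiff ℝ 1 (d i) := by
    intro i
    have hrepr : ContDiff ℝ 1 fun x : E => b.repr x i := by
      simp_rw [b.repr_apply_apply]
      exact (innerSL ℝ (b i)).contDiff
    by_cases hi : 0 < μ i
    · simp only [d, if_pos hi]; exact contDiff_const
    · simp only [d, if_neg hi]
      exact (contDiff_const.mul (hrepr.comp (contDiff_descentIterate hU K))).sub hrepr
  have hdR : ∀ i p, |d i p| ≤ R := by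
    intro i p
    by_cases hi : 0 < μ i
    · simpa only [d, if_pos hi, abs_zero] using hR
    · simp only [d, if_neg hi]
      have habs : |μ i| = -μ i := abs_of_nonpos (not_lt.1 hi)
      set a := 1 - η * μ i
      have ha : 1 ≤ a := by simp only [a]; nlinarith [abs_nonneg (μ i)]
      have hind : ∀ k, |b.repr (descentIterate η U p k) i - a ^ k * b.repr p i| ≤
          R * (a ^ k - 1) := by
        intro k
        induction k with
        | zero => simp [descentIterate]
        | succ k ih =>
          obtain ⟨e, he, hk⟩ := hstep p k i
          rw [hk]
          have h1 : a * b.repr (descentIterate η U p k) i - η * e - a ^ (k + 1) * b.repr p i =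
            a * (b.repr (descentIterate η U p k) i - a ^ k * b.repr p i) - η * e := by ring
          rw [h1]
          calc _ ≤ |a * (b.repr (descentIterate η U p k) i - a ^ k * b.repr p i)| + |η * e| :=
                abs_sub _ _
            _ ≤ a * (R * (a ^ k - 1)) + η * (R * |μ i|) := by
                rw [abs_mul, abs_mul, abs_of_pos hη, abs_of_pos (by linarith : 0 < a)]
                gcongr
                exact he.trans (hRm i)
            _ = R * (a ^ (k + 1) - 1) := by rw [habs]; simp only [a]; ring
      have hak : 0 < a ^ K := by positivity
      have h2 : (a ^ K)⁻¹ * b.repr (descentIterate η U p K) i - b.repr p i =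
          (a ^ K)⁻¹ * (b.repr (descentIterate η U p K) i - a ^ K * b.repr p i) := by
        field_simp
      rw [h2, abs_mul, abs_of_pos (inv_pos.2 hak), inv_mul_le_iff₀ hak]
      nlinarith [hind K]
  obtain ⟨p, hp⟩ := exists_add_eq_zero_of_bounded (fun p => ∑ i, d i p • b i)
    (ContDiff.sum fun i _ => (hd i).smul contDiff_const) (n * R) (fun p => by
      apply hnorm
      intro i
      have : b.repr (∑ j, d j p • b j) i = d i p := by
        simp [map_sum, b.repr_self, Pi.single_apply]
      rw [this]; exact hdR i p)
  have hp' : ∀ i, b.repr p i + d i p = 0 := by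
    intro i
    have h := congrArg (fun x => b.repr x i) hp
    simpa [map_sum, b.repr_self, Pi.single_apply] using h
  refine ⟨p, fun k hk => hnorm _ fun i => ?_⟩
  by_cases hi : 0 < μ i
  · have h0 : b.repr p i = 0 := by simpa [d, hi] using hp' i
    have habs : |μ i| = μ i := abs_of_pos hi
    have hle : 0 ≤ 1 - η * μ i := by
      have := hM i
      rw [habs] at this
      nlinarith
    clear hk
    induction k with
    | zero => simpa [descentIterate, h0] using hR
    | succ k ih =>
      obtain ⟨e, he, hk⟩ := hstep p k i
      rw [hk]
      calc _ ≤ |(1 - η * μ i) * b.repr (descentIterate η U p k) i| + |η * e| := abs_sub _ _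
        _ ≤ (1 - η * μ i) * R + η * (R * |μ i|) := by
            rw [abs_mul, abs_mul, abs_of_pos hη, abs_of_nonneg hle]
            gcongr
            exact he.trans (hRm i)
        _ = R := by rw [habs]; ring
  · have habs : |μ i| = -μ i := abs_of_nonpos (not_lt.1 hi)
    have hpos : 0 < |μ i| := hm.trans_le (hμ i)
    have ha : 0 < 1 - η * μ i := by nlinarith
    have hK : b.repr (descentIterate η U p K) i = 0 := by
      have := hp' i
      simp only [d, if_neg hi, add_sub_cancel] at this
      exact (mul_eq_zero.1 this).resolve_left (by positivity)
    by_contra! hlt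
    have hgrow : ∀ j, R < |b.repr (descentIterate η U p (k + j)) i| := by
      intro j
      induction j with
      | zero => simpa using hlt
      | succ j ih =>
        obtain ⟨e, he, hk'⟩ := hstep p (k + j) i
        rw [← add_assoc, hk']
        have h1 := abs_sub_abs_le_abs_sub
          ((1 - η * μ i) * b.repr (descentIterate η U p (k + j)) i) (η * e)
        rw [abs_mul, abs_mul, abs_of_pos hη, abs_of_pos ha] at h1
        have h2 : η * |e| ≤ η * (R * |μ i|) := by gcongr; exact he.trans (hRm i)
        have h3 : (1 - η * μ i) * R < (1 - η * μ i) *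
          |b.repr (descentIterate η U p (k + j)) i| := by gcongr
        rw [habs] at h2
        nlinarith
    have := hgrow (K - k)
    rw [Nat.add_sub_cancel' hk, hK, abs_zero] at this
    linarith

/-- Comparison of minimax values: if `S₀ ≤ S₁` have pseudo-gradients at bounded distance from the
same nondegenerate symmetric linear map, then some almost critical value of `S₀` is at most some
almost critical value of `S₁`. -/
theorem exists_almost_critical_le {S₀ S₁ : E → ℝ} {V₀ V₁ : E → E} (hS₀ : ContDiff ℝ 2 S₀)
    (hS₁ : ContDiff ℝ 2 S₁) (hV₀ : ContDiff ℝ 1 V₀) (hV₁ : ContDiff ℝ 1 V₁)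
    (hle : ∀ x, S₀ x ≤ S₁ x) {J : E →ₗ[ℝ] E} (hJ : J.IsSymmetric) (hJi : Function.Injective J)
    {C c : ℝ} (hc : 0 < c) (hC₀ : ∀ x, ‖V₀ x - J x‖ ≤ C) (hC₁ : ∀ x, ‖V₁ x - J x‖ ≤ C)
    (hd₀ : ∀ x, c * ‖V₀ x‖ ^ 2 ≤ fderiv ℝ S₀ x (V₀ x))
    (hd₁ : ∀ x, c * ‖V₁ x‖ ^ 2 ≤ fderiv ℝ S₁ x (V₁ x)) {δ : ℝ} (hδ : 0 < δ) :
    ∃ x₀ x₁, ‖V₀ x₀‖ ≤ δ ∧ ‖V₁ x₁‖ ≤ δ ∧ S₀ x₀ ≤ S₁ x₁ := by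
  have hC : 0 ≤ C := (norm_nonneg _).trans (hC₀ 0)
  set n := Module.finrank ℝ E with hn
  set b := hJ.eigenvectorBasis hn.symm
  set μ := hJ.eigenvalues hn.symm
  have hJb : ∀ i, J (b i) = μ i • b i := fun i => hJ.apply_eigenvectorBasis hn.symm i
  have hμ0 : ∀ i, μ i ≠ 0 := by
    intro i hi
    have h := hJb i
    rw [hi, zero_smul] at h
    have := (map_eq_zero_iff J hJi).1 h
    have h1 := b.norm_eq_one i
    rw [this] at h1
    simp at h1
  have hrepr : ∀ x i, b.repr (J x) i = μ i * b.repr x i := by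
    intro x i
    rw [b.repr_apply_apply, b.repr_apply_apply, ← hJ, hJb, inner_smul_left]
    simp
  obtain ⟨m, hm, hμm⟩ : ∃ m > 0, ∀ i, m ≤ |μ i| := by
    have hfin : (Set.range fun i => |μ i|).Finite := Set.finite_range _
    rcases isEmpty_or_nonempty (Fin n) with he | hne
    · exact ⟨1, one_pos, fun i => he.elim i⟩
    · obtain ⟨i, hi⟩ := Finite.exists_min fun i => |μ i|
      exact ⟨|μ i|, abs_pos.2 (hμ0 i), hi⟩
  obtain ⟨M, hM⟩ : ∃ M, ∀ i, |μ i| ≤ M :=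
    ⟨∑ i, |μ i|, fun i => Finset.single_le_sum (f := fun i => |μ i|)
      (fun _ _ => abs_nonneg _) (Finset.mem_univ i)⟩
  set ρ := n * (C / m)
  obtain ⟨L₀, hL₀, hT₀⟩ := exists_taylor_upper_bound hS₀ ρ
  obtain ⟨L₁, hL₁, hT₁⟩ := exists_taylor_upper_bound hS₁ ρ
  obtain ⟨D₀, hD₀⟩ := (isCompact_closedBall (0 : E) ρ).exists_bound_of_continuousOn
    hS₀.continuous.continuousOn
  obtain ⟨D₁, hD₁⟩ := (isCompact_closedBall (0 : E) ρ).exists_bound_of_continuousOn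
    hS₁.continuous.continuousOn
  obtain ⟨η, hη, hηM, hηL₀, hηL₁⟩ : ∃ η > 0, η * M ≤ 1 ∧ L₀ * η ≤ c / 2 ∧ L₁ * η ≤ c / 2 := by
    have h1 : 0 < |M| + 1 := by positivity
    have h2 : 0 < L₀ + L₁ + 1 := by positivity
    refine ⟨min (|M| + 1)⁻¹ (c / 2 / (L₀ + L₁ + 1)), by positivity, ?_, ?_, ?_⟩
    · calc _ ≤ min (|M| + 1)⁻¹ (c / 2 / (L₀ + L₁ + 1)) * (|M| + 1) := by
            gcongr
            linarith [le_abs_self M]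
        _ ≤ (|M| + 1)⁻¹ * (|M| + 1) := by
            gcongr
            exact min_le_left _ _
        _ = 1 := inv_mul_cancel₀ h1.ne'
    · calc _ ≤ (L₀ + L₁ + 1) * (c / 2 / (L₀ + L₁ + 1)) := by
            gcongr ?_ * ?_
            · linarith
            · exact min_le_right _ _
        _ = _ := by field_simp
    · calc _ ≤ (L₀ + L₁ + 1) * (c / 2 / (L₀ + L₁ + 1)) := by
            gcongr ?_ * ?_
            · linarith
            · exact min_le_right _ _
        _ = _ := by field_simp
  have hκ : 0 < η * c / 2 * δ ^ 2 := by positivity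
  obtain ⟨T, hT⟩ := exists_nat_gt ((2 * max D₀ D₁) / (η * c / 2 * δ ^ 2))
  rw [div_lt_iff₀ hκ] at hT
  set U : ℕ → E → E := fun k => if k < T then V₁ else V₀
  have hU : ∀ k, ContDiff ℝ 1 (U k) := fun k => by simp only [U]; split_ifs <;> assumption
  have hUC : ∀ k x i, |b.repr (U k x) i - μ i * b.repr x i| ≤ C := by
    intro k x i
    have h1 : b.repr (U k x) i - μ i * b.repr x i = inner ℝ (b i) (U k x - J x) := by
      rw [← hrepr, inner_sub_right, b.repr_apply_apply, b.repr_apply_apply]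
    rw [h1]
    refine (abs_real_inner_le_norm _ _).trans ?_
    rw [b.norm_eq_one, one_mul]
    simp only [U]
    split_ifs
    exacts [hC₁ x, hC₀ x]
  obtain ⟨p, hp⟩ := exists_bounded_descentIterate b hm hμm hM hη hηM hC hU hUC (2 * T)
  set ξ := descentIterate η U p
  obtain ⟨k₁, _, hk₁, hk₁', _⟩ := exists_almost_critical_of_descent (D := max D₀ D₁) hd₁ hT₁ hc hη
    hηL₁ hδ (fun x hx => (hD₁ x hx).trans (le_max_right _ _)) hT ξ
    (fun k hk => by simpa using hp k (by omega)) (fun k hk => by simp [ξ, descentIterate, U, hk])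
  obtain ⟨k₀, _, hk₀, _, hk₀'⟩ := exists_almost_critical_of_descent (D := max D₀ D₁) hd₀ hT₀ hc hη
    hηL₀ hδ (fun x hx => (hD₀ x hx).trans (le_max_left _ _)) hT (fun k => ξ (T + k))
    (fun k hk => by simpa using hp (T + k) (by omega))
    (fun k hk => by simp [ξ, ← add_assoc, descentIterate, U])
  exact ⟨_, _, hk₀, hk₁, hk₀'.trans ((hle _).trans hk₁')⟩

end Minimax

section DiscreteAction

/-- The three partial derivatives of a function on `ℝ³`. -/
noncomputable def partialX (F : ℝ × ℝ × ℝ → ℝ) (p : ℝ × ℝ × ℝ) : ℝ := fderiv ℝ F p (1, 0, 0)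

/-- The partial derivative in the fibre coordinate `y`. -/
noncomputable def partialY (F : ℝ × ℝ × ℝ → ℝ) (p : ℝ × ℝ × ℝ) : ℝ := fderiv ℝ F p (0, 1, 0)

/-- The partial derivative in the coordinate `z`. -/
noncomputable def partialZ (F : ℝ × ℝ × ℝ → ℝ) (p : ℝ × ℝ × ℝ) : ℝ := fderiv ℝ F p (0, 0, 1)

lemma fderiv_apply_eq_partials (F : ℝ × ℝ × ℝ → ℝ) (p : ℝ × ℝ × ℝ) (a b c : ℝ) :
    fderiv ℝ F p (a, b, c) = a * partialX F p + b * partialY F p + c * partialZ F p := by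
  have : ((a, b, c) : ℝ × ℝ × ℝ) =
      a • ((1, 0, 0) : ℝ × ℝ × ℝ) + b • ((0, 1, 0) : ℝ × ℝ × ℝ) + c • ((0, 0, 1) : ℝ × ℝ × ℝ) := by
    simp
  rw [this, map_add, map_add, map_smul, map_smul, map_smul]
  simp [partialX, partialY, partialZ]

/-- `(x, q, z)` is a discrete characteristic, up to errors `δ`, of the step Hamiltonians `F k`,
starting on the 1-jet graph of `u` and ending over the point `0`. -/
structure IsAlmostCharacteristic (u : ℝ → ℝ) (F : ℕ → ℝ × ℝ × ℝ → ℝ) (N : ℕ) (δ : ℝ)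
    (x q z : ℕ → ℝ) : Prop where
  x_end : x N = 0
  q_zero : q 0 = deriv u (x 0)
  z_zero : z 0 = u (x 0)
  z_succ : ∀ k < N, z (k + 1) =
    z k + q (k + 1) * (x (k + 1) - x k) - F k (x k, q (k + 1), z k)
  x_succ : ∀ k < N, |x (k + 1) - x k - partialY (F k) (x k, q (k + 1), z k)| ≤ δ
  q_succ : ∀ k < N, |q k - (q (k + 1) + partialX (F k) (x k, q (k + 1), z k)) /
    (1 - partialZ (F k) (x k, q (k + 1), z k))| ≤ δ

/-- Configurations of `N` base points and `N` momenta. -/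
abbrev Config (N : ℕ) := EuclideanSpace ℝ (Fin N ⊕ Fin N)

namespace Config

variable {N : ℕ}

/-- The base points, with value `0` from index `N` on. -/
noncomputable def base (k : ℕ) : Config N →L[ℝ] ℝ :=
  if h : k < N then EuclideanSpace.proj (Sum.inl ⟨k, h⟩) else 0

/-- The momenta, with value `0` from index `N` on. -/
noncomputable def momentum (k : ℕ) : Config N →L[ℝ] ℝ :=
  if h : k < N then EuclideanSpace.proj (Sum.inr ⟨k, h⟩) else 0

/-- The momenta shifted by one index, starting with `0`. -/
noncomputable def shiftedMomentum : ℕ → Config N →L[ℝ] ℝ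
  | 0 => 0
  | k + 1 => momentum k

/-- The configuration with given base points and momenta. -/
noncomputable def mk (a b : ℕ → ℝ) : Config N :=
  WithLp.toLp 2 (Sum.elim (fun k => a k) (fun k => b k))

lemma base_mk (a b : ℕ → ℝ) {k : ℕ} (hk : k < N) : base k (mk a b : Config N) = a k := by
  simp [base, mk, hk]

lemma momentum_mk (a b : ℕ → ℝ) {k : ℕ} (hk : k < N) : momentum k (mk a b : Config N) = b k := by
  simp [momentum, mk, hk]

lemma base_end : base N = (0 : Config N →L[ℝ] ℝ) := by simp [base]

lemma inner_eq (ξ η : Config N) : inner ℝ ξ η =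
    ∑ k ∈ Finset.range N, (base k ξ * base k η + momentum k ξ * momentum k η) := by
  rw [PiLp.inner_apply, Fintype.sum_sum_type, ← Finset.sum_add_distrib,
    ← Fin.sum_univ_eq_sum_range (fun k => base k ξ * base k η + momentum k ξ * momentum k η)]
  refine Finset.sum_congr rfl fun k _ => ?_
  simp [base, momentum, mul_comm]

lemma norm_sq_eq (ξ : Config N) : ‖ξ‖ ^ 2 =
    ∑ k ∈ Finset.range N, (base k ξ ^ 2 + momentum k ξ ^ 2) := by
  rw [← real_inner_self_eq_norm_sq, inner_eq]
  exact Finset.sum_congr rfl fun k _ => by ring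

lemma ext_coord {ξ η : Config N} (h₁ : ∀ k < N, base k ξ = base k η)
    (h₂ : ∀ k < N, momentum k ξ = momentum k η) : ξ = η := by
  ext i
  rcases i with ⟨k, hk⟩ | ⟨k, hk⟩
  · simpa [base, hk] using h₁ k hk
  · simpa [momentum, hk] using h₂ k hk

lemma norm_le_of_coord_le {ξ : Config N} {C : ℝ} (h₁ : ∀ k < N, |base k ξ| ≤ C)
    (h₂ : ∀ k < N, |momentum k ξ| ≤ C) : ‖ξ‖ ≤ √(N * (C ^ 2 + C ^ 2)) := by
  apply Real.le_sqrt_of_sq_le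
  rw [norm_sq_eq]
  calc _ ≤ ∑ _k ∈ Finset.range N, (C ^ 2 + C ^ 2) := by
        refine Finset.sum_le_sum fun k hk => ?_
        have hk := Finset.mem_range.1 hk
        exact add_le_add (sq_le_sq' (abs_le.1 (h₁ k hk)).1 (abs_le.1 (h₁ k hk)).2)
          (sq_le_sq' (abs_le.1 (h₂ k hk)).1 (abs_le.1 (h₂ k hk)).2)
    _ = _ := by simp [mul_add]

lemma contDiff_mk {n : WithTop ℕ∞} {G : Type*} [NormedAddCommGroup G] [NormedSpace ℝ G]
    {a b : G → ℕ → ℝ} (ha : ∀ k < N, ContDiff ℝ n fun ξ => a ξ k)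
    (hb : ∀ k < N, ContDiff ℝ n fun ξ => b ξ k) :
    ContDiff ℝ n fun ξ => (mk (a ξ) (b ξ) : Config N) := by
  rw [contDiff_euclidean]
  rintro (⟨k, hk⟩ | ⟨k, hk⟩)
  · exact ha k hk
  · exact hb k hk

/-- The gradient of the quadratic form `∑ yₖ (xₖ₊₁ - xₖ)`. -/
noncomputable def hyperbolic : Config N →ₗ[ℝ] Config N where
  toFun ξ := mk (fun k => shiftedMomentum k ξ - momentum k ξ) (fun k => base (k + 1) ξ - base k ξ)
  map_add' ξ η := by
    refine ext_coord (fun k hk => ?_) (fun k hk => ?_) <;>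
      simp only [map_add, base_mk _ _ hk, momentum_mk _ _ hk] <;> ring
  map_smul' c ξ := by
    refine ext_coord (fun k hk => ?_) (fun k hk => ?_) <;>
      simp only [map_smul, base_mk _ _ hk, momentum_mk _ _ hk, smul_eq_mul, RingHom.id_apply] <;>
      ring

lemma base_hyperbolic (ξ : Config N) {k : ℕ} (hk : k < N) :
    base k (hyperbolic ξ) = shiftedMomentum k ξ - momentum k ξ :=
  base_mk (fun k => shiftedMomentum k ξ - momentum k ξ) (fun k => base (k + 1) ξ - base k ξ) hk

lemma momentum_hyperbolic (ξ : Config N) {k : ℕ} (hk : k < N) :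
    momentum k (hyperbolic ξ) = base (k + 1) ξ - base k ξ :=
  momentum_mk (fun k => shiftedMomentum k ξ - momentum k ξ) (fun k => base (k + 1) ξ - base k ξ) hk

lemma sum_shiftedMomentum_mul_base (ξ η : Config N) :
    ∑ k ∈ Finset.range N, shiftedMomentum k ξ * base k η =
      ∑ k ∈ Finset.range N, momentum k ξ * base (k + 1) η := by
  have h := (Finset.sum_range_succ (fun k => shiftedMomentum k ξ * base k η) N).symm.trans
    (Finset.sum_range_succ' (fun k => shiftedMomentum k ξ * base k η) N)
  simpa [base_end, shiftedMomentum] using h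

lemma isSymmetric_hyperbolic : (hyperbolic : Config N →ₗ[ℝ] Config N).IsSymmetric := by
  intro ξ η
  have h₁ := sum_shiftedMomentum_mul_base ξ η
  have h₂ := sum_shiftedMomentum_mul_base η ξ
  have e₁ : inner ℝ (hyperbolic ξ) η = ∑ k ∈ Finset.range N, shiftedMomentum k ξ * base k η +
      ∑ k ∈ Finset.range N, momentum k η * base (k + 1) ξ -
      ∑ k ∈ Finset.range N, (momentum k ξ * base k η + momentum k η * base k ξ) := by
    rw [inner_eq, ← Finset.sum_add_distrib, ← Finset.sum_sub_distrib]
    refine Finset.sum_congr rfl fun k hk => ?_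
    rw [base_hyperbolic _ (Finset.mem_range.1 hk), momentum_hyperbolic _ (Finset.mem_range.1 hk)]
    ring
  have e₂ : inner ℝ ξ (hyperbolic η) = ∑ k ∈ Finset.range N, shiftedMomentum k η * base k ξ +
      ∑ k ∈ Finset.range N, momentum k ξ * base (k + 1) η -
      ∑ k ∈ Finset.range N, (momentum k ξ * base k η + momentum k η * base k ξ) := by
    rw [inner_eq, ← Finset.sum_add_distrib, ← Finset.sum_sub_distrib]
    refine Finset.sum_congr rfl fun k hk => ?_
    rw [base_hyperbolic _ (Finset.mem_range.1 hk), momentum_hyperbolic _ (Finset.mem_range.1 hk)]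
    ring
  change inner ℝ (hyperbolic ξ) η = inner ℝ ξ (hyperbolic η)
  rw [e₁, e₂]
  linarith

lemma injective_hyperbolic : Function.Injective (hyperbolic : Config N →ₗ[ℝ] Config N) := by
  rw [injective_iff_map_eq_zero]
  intro ξ hξ
  have hx : ∀ k < N, base (k + 1) ξ = base k ξ := fun k hk => by
    have := momentum_hyperbolic ξ hk
    rw [hξ, map_zero] at this
    linarith
  have hy : ∀ k < N, shiftedMomentum k ξ = momentum k ξ := fun k hk => by
    have := base_hyperbolic ξ hk
    rw [hξ, map_zero] at this
    linarith
  refine ext_coord (fun k hk => ?_) (fun k hk => ?_)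
  · have : ∀ k ≤ N, base k ξ = base 0 ξ := by
      intro k
      induction k with
      | zero => simp
      | succ k ih => exact fun hk => (hx k hk).trans (ih (by omega))
    rw [map_zero, this k hk.le, ← this N le_rfl, base_end, zero_apply]
  · rw [map_zero]
    induction k with
    | zero => exact (hy 0 hk).symm
    | succ k ih => exact (hy _ hk).symm.trans (ih (by omega))

variable (u : ℝ → ℝ) (F : ℕ → ℝ × ℝ × ℝ → ℝ)

/-- The discrete action accumulated after `k` steps. -/
noncomputable def action (ξ : Config N) : ℕ → ℝ
  | 0 => u (base 0 ξ)
  | k + 1 => action ξ k + momentum k ξ * (base (k + 1) ξ - base k ξ) -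
      F k (base k ξ, momentum k ξ, action ξ k)

/-- The phase point at which the `k`-th step Hamiltonian is evaluated. -/
noncomputable def phase (ξ : Config N) (k : ℕ) : ℝ × ℝ × ℝ :=
  (base k ξ, momentum k ξ, action u F ξ k)

/-- The momentum arriving at the `k`-th base point. -/
noncomputable def incoming (ξ : Config N) : ℕ → ℝ
  | 0 => deriv u (base 0 ξ)
  | k + 1 => momentum k ξ

/-- The defect in the equation for the base point. -/
noncomputable def baseDefect (ξ : Config N) (k : ℕ) : ℝ :=
  base (k + 1) ξ - base k ξ - partialY (F k) (phase u F ξ k)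

/-- The defect in the equation for the momentum. -/
noncomputable def momentumDefect (ξ : Config N) (k : ℕ) : ℝ :=
  incoming u ξ k - (momentum k ξ + partialX (F k) (phase u F ξ k)) /
    (1 - partialZ (F k) (phase u F ξ k))

/-- A pseudo-gradient of the discrete action. -/
noncomputable def pseudoGradient (ξ : Config N) : Config N :=
  mk (momentumDefect u F ξ) (baseDefect u F ξ)

variable {u F}

lemma contDiff_action (hu : ContDiff ℝ 2 u) (hF : ∀ k, ContDiff ℝ 2 (F k)) (k : ℕ) :
    ContDiff ℝ 2 fun ξ : Config N => action u F ξ k := by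
  induction k with
  | zero => exact hu.comp (base 0).contDiff
  | succ k ih =>
    exact (ih.add ((momentum k).contDiff.mul ((base (k + 1)).contDiff.sub (base k).contDiff))).sub
      ((hF k).comp ((base k).contDiff.prodMk ((momentum k).contDiff.prodMk ih)))

lemma contDiff_pseudoGradient (hu : ContDiff ℝ 2 u) (hF : ∀ k, ContDiff ℝ 2 (F k))
    (hz : ∀ k p, |partialZ (F k) p| ≤ 1 / 2) :
    ContDiff ℝ 1 fun ξ : Config N => pseudoGradient u F ξ := by
  have hphase : ∀ k, ContDiff ℝ 1 fun ξ : Config N => phase u F ξ k := fun k =>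
    (base k).contDiff.prodMk ((momentum k).contDiff.prodMk
      ((contDiff_action hu hF k).of_le one_le_two))
  have hpartial : ∀ k (v : ℝ × ℝ × ℝ),
      ContDiff ℝ 1 fun ξ : Config N => fderiv ℝ (F k) (phase u F ξ k) v := fun k v =>
    (((hF k).fderiv_right (m := 1) (by norm_num)).comp (hphase k)).clm_apply contDiff_const
  refine contDiff_mk (fun k _ => ?_) (fun k _ => ?_)
  · refine ContDiff.sub ?_ (ContDiff.div ?_ ?_ ?_)
    · cases k with
      | zero =>
        have hu' : ContDiff ℝ 1 (deriv u) :=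
          ((contDiff_succ_iff_deriv (n := 1)).1 hu).2.2
        exact hu'.comp (base 0).contDiff
      | succ k => exact (momentum k).contDiff
    · exact (momentum k).contDiff.add (hpartial k _)
    · exact contDiff_const.sub (hpartial k _)
    · intro ξ
      have := (abs_le.1 (hz k (phase u F ξ k))).2
      linarith
  · exact ((base (k + 1)).contDiff.sub (base k).contDiff).sub (hpartial k _)

lemma action_mono {w : ℝ → ℝ} (hF : ∀ k, ContDiff ℝ 2 (F k))
    (hz : ∀ k p, |partialZ (F k) p| ≤ 1 / 2) (h : ∀ x, u x ≤ w x) (ξ : Config N) (k : ℕ) :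
    action u F ξ k ≤ action w F ξ k := by
  induction k with
  | zero => exact h _
  | succ k ih =>
    simp only [action]
    set a := action u F ξ k
    set b := action w F ξ k
    have hlip : |F k (base k ξ, momentum k ξ, b) - F k (base k ξ, momentum k ξ, a)| ≤
        1 / 2 * |b - a| := by
      have hd : ∀ s, HasDerivAt (fun s => F k (base k ξ, momentum k ξ, s))
          (partialZ (F k) (base k ξ, momentum k ξ, s)) s := fun s => by
        have h1 := ((hF k).differentiable two_ne_zero
          (base k ξ, momentum k ξ, s)).hasFDerivAt
        have h2 : HasDerivAt (fun s : ℝ => ((base k ξ, momentum k ξ, s) : ℝ × ℝ × ℝ)) (0, 0, 1) s :=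
          (hasDerivAt_const s _).prodMk ((hasDerivAt_const s _).prodMk (hasDerivAt_id s))
        exact h1.comp_hasDerivAt s h2
      exact convex_univ.norm_image_sub_le_of_norm_hasDerivWithin_le
        (fun s _ => (hd s).hasDerivWithinAt) (fun s _ => hz k _) (Set.mem_univ a) (Set.mem_univ b)
    rw [abs_of_nonneg (sub_nonneg.2 ih)] at hlip
    linarith [(abs_le.1 hlip).2]

lemma norm_pseudoGradient_sub_hyperbolic_le {C Cu : ℝ} (hCu : ∀ x, |deriv u x| ≤ Cu)
    (hx : ∀ k p, |partialX (F k) p| ≤ C) (hy : ∀ k p, |partialY (F k) p| ≤ C)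
    (hyz : ∀ k (p : ℝ × ℝ × ℝ), |p.2.1 * partialZ (F k) p| ≤ C)
    (hz : ∀ k p, |partialZ (F k) p| ≤ 1 / 2) (ξ : Config N) :
    ‖pseudoGradient u F ξ - hyperbolic ξ‖ ≤ √(N * ((Cu + 4 * C) ^ 2 + (Cu + 4 * C) ^ 2)) := by
  have hCu0 : 0 ≤ Cu := (abs_nonneg _).trans (hCu 0)
  have hC0 : 0 ≤ C := (abs_nonneg _).trans (hx 0 0)
  refine norm_le_of_coord_le (fun k hk => ?_) (fun k hk => ?_)
  · rw [map_sub, base_hyperbolic ξ hk, pseudoGradient, base_mk _ _ hk, momentumDefect]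
    set p := phase u F ξ k with hp
    have hpy : p.2.1 = momentum k ξ := rfl
    have hpos : 1 / 2 ≤ 1 - partialZ (F k) p := by linarith [(abs_le.1 (hz k p)).2]
    have e : incoming u ξ k - (momentum k ξ + partialX (F k) p) / (1 - partialZ (F k) p) -
        (shiftedMomentum k ξ - momentum k ξ) = (incoming u ξ k - shiftedMomentum k ξ) -
        (partialX (F k) p + p.2.1 * partialZ (F k) p) / (1 - partialZ (F k) p) := by
      have : 1 - partialZ (F k) p ≠ 0 := by linarith
      rw [hpy]
      field_simp
      ring
    rw [e]
    have h1 : |incoming u ξ k - shiftedMomentum k ξ| ≤ Cu := by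
      cases k with
      | zero => simpa [incoming, shiftedMomentum] using hCu _
      | succ k => simpa [incoming, shiftedMomentum] using hCu0
    have h2 : |(partialX (F k) p + p.2.1 * partialZ (F k) p) / (1 - partialZ (F k) p)| ≤
        4 * C := by
      rw [abs_div, abs_of_pos (by linarith : 0 < 1 - partialZ (F k) p), div_le_iff₀ (by linarith)]
      have := (abs_add_le (partialX (F k) p) (p.2.1 * partialZ (F k) p)).trans
        (add_le_add (hx k p) (hyz k p))
      nlinarith
    exact (abs_sub _ _).trans (add_le_add h1 h2)
  · rw [map_sub, momentum_hyperbolic ξ hk, pseudoGradient, momentum_mk _ _ hk, baseDefect]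
    rw [sub_sub_cancel_left, abs_neg]
    linarith [hy k (phase u F ξ k)]

lemma fderiv_action_succ (hu : ContDiff ℝ 2 u) (hF : ∀ k, ContDiff ℝ 2 (F k)) (k : ℕ)
    (ξ v : Config N) :
    fderiv ℝ (fun ξ : Config N => action u F ξ (k + 1)) ξ v =
      fderiv ℝ (fun ξ : Config N => action u F ξ k) ξ v +
      (momentum k ξ * (base (k + 1) v - base k v) +
        momentum k v * (base (k + 1) ξ - base k ξ)) -
      (base k v * partialX (F k) (phase u F ξ k) + momentum k v * partialY (F k) (phase u F ξ k) +
        fderiv ℝ (fun ξ : Config N => action u F ξ k) ξ v * partialZ (F k) (phase u F ξ k)) := by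
  have hz := ((contDiff_action hu hF k).differentiable two_ne_zero ξ).hasFDerivAt
  have hf := ((hF k).differentiable two_ne_zero (phase u F ξ k)).hasFDerivAt
  have hX := (base (N := N) k).hasFDerivAt (x := ξ)
  have hX' := (base (N := N) (k + 1)).hasFDerivAt (x := ξ)
  have hY := (momentum (N := N) k).hasFDerivAt (x := ξ)
  have hcomp := hf.comp ξ (hX.prodMk (hY.prodMk hz))
  have h := (hz.add (hY.mul (hX'.sub hX))).sub hcomp
  have heq : (fun ξ : Config N => action u F ξ (k + 1)) =
      ((fun ξ : Config N => action u F ξ k) + (⇑(momentum k) * (⇑(base (k + 1)) - ⇑(base k)))) -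
        (F k ∘ fun ξ : Config N => (base k ξ, momentum k ξ, action u F ξ k)) := rfl
  rw [heq, h.fderiv, ← fderiv_apply_eq_partials]
  simp [mul_comm]

lemma le_fderiv_action_pseudoGradient (hu : ContDiff ℝ 2 u) (hF : ∀ k, ContDiff ℝ 2 (F k))
    (hz : ∀ k p, |partialZ (F k) p| ≤ 1 / 2) (ξ : Config N) :
    (1 / 2) ^ N * ‖pseudoGradient u F ξ‖ ^ 2 ≤
      fderiv ℝ (fun ξ : Config N => action u F ξ N) ξ (pseudoGradient u F ξ) := by
  set v := pseudoGradient u F ξ with hv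
  have hX : ∀ k < N, base k v = momentumDefect u F ξ k := fun k hk => base_mk _ _ hk
  have hY : ∀ k < N, momentum k v = baseDefect u F ξ k := fun k hk => momentum_mk _ _ hk
  set w : ℕ → ℝ := fun k => fderiv ℝ (fun ξ : Config N => action u F ξ k) ξ v -
    incoming u ξ k * base k v with hw
  have hsucc : ∀ k < N, w (k + 1) = (1 - partialZ (F k) (phase u F ξ k)) *
      (w k + base k v ^ 2) + momentum k v ^ 2 := by
    intro k hk
    have hpos : 1 - partialZ (F k) (phase u F ξ k) ≠ 0 := by
      have := (abs_le.1 (hz k (phase u F ξ k))).2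
      linarith
    have hB : (1 - partialZ (F k) (phase u F ξ k)) * base k v =
        (1 - partialZ (F k) (phase u F ξ k)) * incoming u ξ k -
          (momentum k ξ + partialX (F k) (phase u F ξ k)) := by
      rw [hX k hk, momentumDefect]
      field_simp
    have hA : momentum k v = base (k + 1) ξ - base k ξ - partialY (F k) (phase u F ξ k) := hY k hk
    have hin : incoming u ξ (k + 1) = momentum k ξ := rfl
    simp only [hw, fderiv_action_succ hu hF, hin]
    linear_combination (-base k v) * hB - momentum k v * hA
  have h0 : w 0 = 0 := by
    have h1 : HasFDerivAt (fun ξ : Config N => action u F ξ 0) _ ξ :=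
      ((hu.differentiable two_ne_zero (base 0 ξ)).hasDerivAt).comp_hasFDerivAt ξ
        ((base (N := N) 0).hasFDerivAt (x := ξ))
    simp only [hw, h1.fderiv, incoming]
    simp
  have hmain : ∀ k ≤ N, (1 / 2) ^ k * ∑ j ∈ Finset.range k, (base j v ^ 2 + momentum j v ^ 2) ≤
      w k := by
    intro k
    induction k with
    | zero => simp [h0]
    | succ k ih =>
      intro hk
      have ih := ih (by omega)
      rw [hsucc k hk, Finset.sum_range_succ, pow_succ]
      have hsum : 0 ≤ ∑ j ∈ Finset.range k, (base j v ^ 2 + momentum j v ^ 2) := by positivity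
      have hhalf : (1 / 2 : ℝ) ^ k ≤ 1 := pow_le_one₀ (by norm_num) (by norm_num)
      have hhalf0 : (0 : ℝ) ≤ (1 / 2 : ℝ) ^ k := by positivity
      have hw0 : 0 ≤ w k := (mul_nonneg hhalf0 hsum).trans ih
      have hp : 1 / 2 ≤ 1 - partialZ (F k) (phase u F ξ k) := by
        linarith [(abs_le.1 (hz k (phase u F ξ k))).2]
      have h1 : 1 / 2 * (w k + base k v ^ 2) ≤ (1 - partialZ (F k) (phase u F ξ k)) *
        (w k + base k v ^ 2) := by gcongr
      have h2 : (1 / 2 : ℝ) ^ k * (base k v ^ 2 + momentum k v ^ 2) ≤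
        1 * (base k v ^ 2 + momentum k v ^ 2) := by gcongr
      nlinarith [sq_nonneg (momentum k v)]
  have h := hmain N le_rfl
  rw [← norm_sq_eq] at h
  simpa [hw, base_end] using h

lemma isAlmostCharacteristic {δ : ℝ} {ξ : Config N} (h : ‖pseudoGradient u F ξ‖ ≤ δ) :
    IsAlmostCharacteristic u F N δ (fun k => base k ξ) (incoming u ξ) (action u F ξ) := by
  have hcoord : ∀ k < N, |base k (pseudoGradient u F ξ)| ≤ δ ∧
      |momentum k (pseudoGradient u F ξ)| ≤ δ := by
    intro k hk
    have hle : base k (pseudoGradient u F ξ) ^ 2 + momentum k (pseudoGradient u F ξ) ^ 2 ≤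
        ‖pseudoGradient u F ξ‖ ^ 2 := by
      rw [norm_sq_eq]
      exact Finset.single_le_sum (f := fun k => base k (pseudoGradient u F ξ) ^ 2 +
        momentum k (pseudoGradient u F ξ) ^ 2) (fun _ _ => by positivity) (Finset.mem_range.2 hk)
    constructor
    · exact (abs_le_of_sq_le_sq (le_trans (by nlinarith) hle) (norm_nonneg _)).trans h
    · exact (abs_le_of_sq_le_sq (le_trans (by nlinarith) hle) (norm_nonneg _)).trans h
  exact
    { x_end := by simp [base_end]
      q_zero := rfl
      z_zero := rfl
      z_succ := fun k _ => rfl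
      x_succ := fun k hk => by
        have := (hcoord k hk).2
        rwa [pseudoGradient, momentum_mk _ _ hk] at this
      q_succ := fun k hk => by
        have := (hcoord k hk).1
        rwa [pseudoGradient, base_mk _ _ hk] at this }

end Config

/-- For ordered initial data, there are almost characteristics with ordered final values. -/
theorem exists_isAlmostCharacteristic_le {u w : ℝ → ℝ} (hu : ContDiff ℝ 2 u) (hw : ContDiff ℝ 2 w)
    (huw : ∀ x, u x ≤ w x) {C Cu : ℝ} (hCu : ∀ x, |deriv u x| ≤ Cu) (hCw : ∀ x, |deriv w x| ≤ Cu)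
    {F : ℕ → ℝ × ℝ × ℝ → ℝ} (hF : ∀ k, ContDiff ℝ 2 (F k))
    (hx : ∀ k p, |partialX (F k) p| ≤ C) (hy : ∀ k p, |partialY (F k) p| ≤ C)
    (hyz : ∀ k (p : ℝ × ℝ × ℝ), |p.2.1 * partialZ (F k) p| ≤ C)
    (hz : ∀ k p, |partialZ (F k) p| ≤ 1 / 2) (N : ℕ) {δ : ℝ} (hδ : 0 < δ) :
    ∃ x q z x' q' z', IsAlmostCharacteristic u F N δ x q z ∧
      IsAlmostCharacteristic w F N δ x' q' z' ∧ z N ≤ z' N := by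
  obtain ⟨ξ, ξ', h, h', hle⟩ := exists_almost_critical_le
    (S₀ := fun ξ : Config N => Config.action u F ξ N)
    (S₁ := fun ξ : Config N => Config.action w F ξ N) (Config.contDiff_action hu hF N)
    (Config.contDiff_action hw hF N) (Config.contDiff_pseudoGradient hu hF hz)
    (Config.contDiff_pseudoGradient hw hF hz) (fun ξ => Config.action_mono hF hz huw ξ N)
    Config.isSymmetric_hyperbolic Config.injective_hyperbolic (by positivity)
    (Config.norm_pseudoGradient_sub_hyperbolic_le hCu hx hy hyz hz)
    (Config.norm_pseudoGradient_sub_hyperbolic_le hCw hx hy hyz hz)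
    (Config.le_fderiv_action_pseudoGradient hu hF hz)
    (Config.le_fderiv_action_pseudoGradient hw hF hz) hδ
  exact ⟨_, _, _, _, _, _, Config.isAlmostCharacteristic h, Config.isAlmostCharacteristic h', hle⟩

end DiscreteAction

section EulerScheme

/-- The contact vector field of a time-dependent Hamiltonian on `ℝ³` with the form `dz - y dx`. -/
noncomputable def contactField (H : ℝ → ℝ × ℝ × ℝ → ℝ) (t : ℝ) (p : ℝ × ℝ × ℝ) : ℝ × ℝ × ℝ :=
  (partialY (H t) p, -(partialX (H t) p + p.2.1 * partialZ (H t) p),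
    p.2.1 * partialY (H t) p - H t p)

lemma norm_triple_le {a b c r : ℝ} (ha : |a| ≤ r) (hb : |b| ≤ r) (hc : |c| ≤ r) :
    ‖((a, b, c) : ℝ × ℝ × ℝ)‖ ≤ r := by
  simp [ha, hb, hc]

lemma norm_sub_sub_fderiv_le_of_convex {E F : Type*} [NormedAddCommGroup E] [NormedSpace ℝ E]
    [NormedAddCommGroup F] [NormedSpace ℝ F] {f : E → F} (hf : ContDiff ℝ 2 f) {s : Set E}
    (hs : Convex ℝ s) {L : ℝ} (hL : ∀ x ∈ s, ‖fderiv ℝ (fderiv ℝ f) x‖ ≤ L) {x y : E}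
    (hx : x ∈ s) (hy : y ∈ s) : ‖f y - f x - fderiv ℝ f x (y - x)‖ ≤ L * ‖y - x‖ ^ 2 := by
  have hd : ContDiff ℝ 1 (fderiv ℝ f) := hf.fderiv_right (by norm_num)
  have hL0 : 0 ≤ L := le_trans (norm_nonneg (fderiv ℝ (fderiv ℝ f) x)) (hL x hx)
  have h := (hs.inter (convex_closedBall x ‖y - x‖)).norm_image_sub_le_of_norm_fderiv_le'
    (f := f) (𝕜 := ℝ) (C := L * ‖y - x‖) (φ := fderiv ℝ f x) (x := x) (y := y)
    (fun z _ => hf.differentiable two_ne_zero z) (fun z hz => by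
      refine (hs.norm_image_sub_le_of_norm_fderiv_le (𝕜 := ℝ)
        (fun x _ => hd.differentiable one_ne_zero x) hL hx hz.1).trans ?_
      have : ‖z - x‖ ≤ ‖y - x‖ := by simpa [dist_eq_norm] using hz.2
      gcongr)
    ⟨hx, by simp⟩ ⟨hy, by simp [dist_eq_norm]⟩
  linarith [h, sq ‖y - x‖, mul_assoc L ‖y - x‖ ‖y - x‖, congrArg (L * ·) (sq ‖y - x‖)]

lemma le_of_discrete_gronwall {d : ℕ → ℝ} {L C : ℝ} (hL : 0 ≤ L) (hC : 0 ≤ C) {N : ℕ}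
    (hN : 0 < N) (h0 : d 0 = 0)
    (hd : ∀ k < N, d (k + 1) ≤ (1 + L / N) * d k + C / N ^ 2) : d N ≤ C * exp L / N := by
  have hN' : (0 : ℝ) < N := by exact_mod_cast hN
  have h : ∀ k ≤ N, d k ≤ k * (C / N ^ 2) * (1 + L / N) ^ k := by
    intro k
    induction k with
    | zero => simp [h0]
    | succ k ih =>
      intro hk
      have h1 : (1 : ℝ) ≤ 1 + L / N := by linarith [show 0 ≤ L / N by positivity]
      calc d (k + 1) ≤ (1 + L / N) * d k + C / N ^ 2 := hd k hk
        _ ≤ (1 + L / N) * (k * (C / N ^ 2) * (1 + L / N) ^ k) + C / N ^ 2 * 1 := by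
          rw [mul_one]; gcongr; exact ih (by omega)
        _ ≤ (1 + L / N) * (k * (C / N ^ 2) * (1 + L / N) ^ k) +
            C / N ^ 2 * (1 + L / N) ^ (k + 1) := by gcongr; exact one_le_pow₀ h1
        _ = _ := by push_cast; ring
  have hexp : (1 + L / N) ^ N ≤ exp L := by
    calc (1 + L / N) ^ N ≤ exp (L / N) ^ N := by
          gcongr; linarith [add_one_le_exp (L / N)]
      _ = exp L := by rw [← exp_nat_mul]; congr 1; field_simp
  calc d N ≤ N * (C / N ^ 2) * (1 + L / N) ^ N := h N le_rfl
    _ ≤ N * (C / N ^ 2) * exp L := by gcongr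
    _ = _ := by field_simp

variable {H : ℝ → ℝ × ℝ × ℝ → ℝ} {M L : ℝ}

lemma IsAlmostCharacteristic.euler_step (hH : ∀ t, Differentiable ℝ (H t))
    (hMx : ∀ t p, |partialX (H t) p| ≤ M)
    (hMz : ∀ t p, |partialZ (H t) p| ≤ M)
    (hMyz : ∀ t (p : ℝ × ℝ × ℝ), |p.2.1 * partialZ (H t) p| ≤ M)
    (hL : ∀ t p p', ‖contactField H t p - contactField H t p'‖ ≤ L * ‖p - p'‖) (hL0 : 0 ≤ L)
    {u : ℝ → ℝ} {Cu : ℝ} (hCu : ∀ x, |deriv u x| ≤ Cu) {N : ℕ} (hN : 0 < N)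
    (hMN : M / N ≤ 1 / 2) {δ : ℝ} (hδ : δ ≤ (1 / N) ^ 2) {x q z : ℕ → ℝ}
    (h : IsAlmostCharacteristic u (fun k p => 1 / N * H (k / N) p) N δ x q z) {k : ℕ} (hk : k < N) :
    ‖((x (k + 1), q (k + 1), z (k + 1)) : ℝ × ℝ × ℝ) - (x k, q k, z k) -
      (1 / N : ℝ) • contactField H (k / N) (x k, q k, z k)‖ ≤
      (Cu + 4 * M + 2 + 4 * M ^ 2 + L * (4 * M + 1)) / N ^ 2 := by
  have hN' : (1 : ℝ) ≤ N := by exact_mod_cast hN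
  set ε : ℝ := 1 / N with hε
  have hε0 : 0 < ε := by positivity
  have hε1 : ε ≤ 1 := by rw [hε, div_le_one (by linarith)]; exact hN'
  have hMε : M * ε ≤ 1 / 2 := by rw [hε, mul_one_div]; exact hMN
  have hM0 : 0 ≤ M := (abs_nonneg _).trans (hMx 0 0)
  have hCu0 : 0 ≤ Cu := (abs_nonneg _).trans (hCu 0)
  have hδ' : δ ≤ ε := hδ.trans (by nlinarith)
  have hpart : ∀ (j : ℕ) (p v : ℝ × ℝ × ℝ),
      fderiv ℝ (fun p => ε * H (j / N) p) p v = ε * fderiv ℝ (H (j / N)) p v := by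
    intro j p v
    rw [fderiv_const_mul (hH _ p)]
    rfl
  -- the momentum equation, solved for the increment
  have hq : ∀ j < N, ∃ r, |r| ≤ (4 * M ^ 2 + 1) * ε ^ 2 ∧ q (j + 1) - q j =
      -ε * (partialX (H (j / N)) (x j, q (j + 1), z j) +
        q (j + 1) * partialZ (H (j / N)) (x j, q (j + 1), z j)) + r := by
    intro j hj
    set p : ℝ × ℝ × ℝ := (x j, q (j + 1), z j) with hp
    have hs := h.q_succ j hj
    simp only [partialX, partialZ, hpart] at hs
    change |q j - (q (j + 1) + ε * partialX (H (j / N)) p) /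
      (1 - ε * partialZ (H (j / N)) p)| ≤ δ at hs
    set a := partialX (H (j / N)) p
    set b := partialZ (H (j / N)) p
    have hb : |ε * b| ≤ 1 / 2 := by
      rw [abs_mul, abs_of_pos hε0]
      nlinarith [hMz (j / N) p]
    have hpos : 1 / 2 ≤ 1 - ε * b := by linarith [(abs_le.1 hb).2]
    have hab : |a + q (j + 1) * b| ≤ 2 * M :=
      (abs_add_le _ _).trans (by linarith [hMx (j / N) p, hMyz (j / N) p])
    refine ⟨q (j + 1) - q j + ε * (a + q (j + 1) * b), ?_, by ring⟩
    have hne : 1 - ε * b ≠ 0 := by linarith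
    have e : q (j + 1) - q j + ε * (a + q (j + 1) * b) =
        -(q j - (q (j + 1) + ε * a) / (1 - ε * b)) -
          ε * (ε * b) * (a + q (j + 1) * b) / (1 - ε * b) := by
      field_simp
      ring
    rw [e]
    have h2 : |ε * (ε * b) * (a + q (j + 1) * b) / (1 - ε * b)| ≤ 4 * M ^ 2 * ε ^ 2 := by
      rw [abs_div, abs_of_pos (by linarith : 0 < 1 - ε * b), div_le_iff₀ (by linarith), abs_mul,
        abs_mul, abs_mul, abs_of_pos hε0]
      calc ε * (ε * |b|) * |a + q (j + 1) * b| ≤ ε * (ε * M) * (2 * M) := by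
            gcongr; exact hMz _ _
        _ = 4 * M ^ 2 * ε ^ 2 * (1 / 2) := by ring
        _ ≤ _ := by gcongr
    calc _ ≤ |-(q j - (q (j + 1) + ε * a) / (1 - ε * b))| + _ := abs_sub _ _
      _ ≤ ε ^ 2 + 4 * M ^ 2 * ε ^ 2 := by
          rw [abs_neg]; exact add_le_add (hs.trans hδ) h2
      _ = _ := by ring
  have hdq : ∀ j < N, |q (j + 1) - q j| ≤ (4 * M + 1) * ε := by
    intro j hj
    obtain ⟨r, hr, hjq⟩ := hq j hj
    have hab := (abs_add_le (partialX (H (j / N)) (x j, q (j + 1), z j))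
      (q (j + 1) * partialZ (H (j / N)) (x j, q (j + 1), z j))).trans
      (add_le_add (hMx _ _) (hMyz _ (x j, q (j + 1), z j)))
    rw [hjq]
    calc _ ≤ |-ε * (partialX (H (j / N)) (x j, q (j + 1), z j) +
        q (j + 1) * partialZ (H (j / N)) (x j, q (j + 1), z j))| + |r| := abs_add_le _ _
      _ ≤ ε * (M + M) + (4 * M ^ 2 + 1) * ε ^ 2 := by
        rw [abs_mul, abs_neg, abs_of_pos hε0]; gcongr
      _ ≤ _ := by nlinarith [mul_nonneg hM0 hε0.le]
  have hqb : ∀ j ≤ N, |q j| ≤ Cu + 4 * M + 1 := by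
    have : ∀ j ≤ N, |q j| ≤ Cu + j * ((4 * M + 1) * ε) := by
      intro j
      induction j with
      | zero => intro _; rw [h.q_zero]; simpa using hCu _
      | succ j ih =>
        intro hj
        have h1 := ih (by omega)
        have h2 := hdq j hj
        have h3 := abs_add_le (q j) (q (j + 1) - q j)
        rw [add_sub_cancel] at h3
        push_cast
        linarith
    intro j hj
    have hjN : (j : ℝ) * ε ≤ 1 := by
      rw [hε, mul_one_div, div_le_one (by linarith)]
      exact_mod_cast hj
    nlinarith [this j hj]
  set p : ℝ × ℝ × ℝ := (x k, q (k + 1), z k) with hp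
  obtain ⟨r, hr, hkq⟩ := hq k hk
  have hx := h.x_succ k hk
  have hz := h.z_succ k hk
  simp only [partialY, hpart] at hx
  change |x (k + 1) - x k - ε * partialY (H (k / N)) p| ≤ δ at hx
  have e : ((x (k + 1), q (k + 1), z (k + 1)) : ℝ × ℝ × ℝ) - (x k, q k, z k) -
      ε • contactField H (k / N) (x k, q k, z k) =
      (x (k + 1) - x k - ε * partialY (H (k / N)) p, r,
        q (k + 1) * (x (k + 1) - x k - ε * partialY (H (k / N)) p)) +
      ε • (contactField H (k / N) p - contactField H (k / N) (x k, q k, z k)) := by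
    rw [smul_sub, ← add_sub_assoc]
    congr 1
    simp only [contactField, hp, Prod.mk_sub_mk, Prod.smul_mk, Prod.mk_add_mk, smul_eq_mul]
    ext
    · simp
    · simp only [hkq]; ring
    · simp only [hz]; ring
  rw [e]
  have h1 : ‖((x (k + 1) - x k - ε * partialY (H (k / N)) p, r,
        q (k + 1) * (x (k + 1) - x k - ε * partialY (H (k / N)) p)) : ℝ × ℝ × ℝ)‖ ≤
      (Cu + 4 * M + 2 + 4 * M ^ 2) * ε ^ 2 := by
    have hx2 := hx.trans hδ
    have hsq : 0 ≤ ε ^ 2 := by positivity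
    have hb0 := mul_nonneg hCu0 hsq
    have hb1 := mul_nonneg hM0 hsq
    have hb2 := mul_nonneg (sq_nonneg M) hsq
    refine norm_triple_le ?_ ?_ ?_
    · linarith
    · linarith
    · rw [abs_mul]
      calc _ ≤ (Cu + 4 * M + 1) * ε ^ 2 := by gcongr; exact hqb _ hk
        _ ≤ _ := by linarith
  have h2 : ‖ε • (contactField H (k / N) p - contactField H (k / N) (x k, q k, z k))‖ ≤
      L * (4 * M + 1) * ε ^ 2 := by
    rw [norm_smul, Real.norm_of_nonneg hε0.le]
    have h3 : ‖p - (x k, q k, z k)‖ ≤ (4 * M + 1) * ε := by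
      rw [hp, Prod.mk_sub_mk, Prod.mk_sub_mk]
      exact norm_triple_le (by simp; positivity) (hdq k hk) (by simp; positivity)
    calc _ ≤ ε * (L * ((4 * M + 1) * ε)) := by
          gcongr; exact (hL _ _ _).trans (by gcongr)
      _ = _ := by ring
  calc _ ≤ _ := norm_add_le _ _
    _ ≤ _ := add_le_add h1 h2
    _ = _ := by rw [hε]; field_simp

/-- If the contact field is tangent, up to a bounded multiple of the tangent vector, to the
isotopy `γ` of 1-jet curves, then almost characteristics end close to the final curve. -/
theorem exists_dist_final_curve_le (hH : ∀ t, Differentiable ℝ (H t))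
    (hMx : ∀ t p, |partialX (H t) p| ≤ M)
    (hMz : ∀ t p, |partialZ (H t) p| ≤ M)
    (hMyz : ∀ t (p : ℝ × ℝ × ℝ), |p.2.1 * partialZ (H t) p| ≤ M)
    (hL : ∀ t p p', ‖contactField H t p - contactField H t p'‖ ≤ L * ‖p - p'‖) (hL0 : 0 ≤ L)
    {u : ℝ → ℝ} {Cu : ℝ} (hCu : ∀ x, |deriv u x| ≤ Cu) {γ : ℝ × ℝ → ℝ × ℝ × ℝ}
    (hγ : ContDiff ℝ 2 γ) (hγ0 : ∀ s, γ (0, s) = (s, deriv u s, u s)) {Ca C₂ : ℝ}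
    (ha : ∀ t ∈ Set.Icc (0 : ℝ) 1, ∀ s, ∃ a, |a| ≤ Ca ∧
      contactField H t (γ (t, s)) = fderiv ℝ γ (t, s) (1, a))
    (hC₂ : ∀ t ∈ Set.Icc (0 : ℝ) 1, ∀ s, ‖fderiv ℝ (fderiv ℝ γ) (t, s)‖ ≤ C₂) :
    ∃ C, ∀ N : ℕ, 0 < N → M / N ≤ 1 / 2 → ∀ δ ≤ (1 / N : ℝ) ^ 2, ∀ x q z,
      IsAlmostCharacteristic u (fun k p => 1 / N * H (k / N) p) N δ x q z →
      ∃ s, ‖((0, q N, z N) : ℝ × ℝ × ℝ) - γ (1, s)‖ ≤ C / N := by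
  have hM0 : 0 ≤ M := (abs_nonneg _).trans (hMx 0 0)
  have hCu0 : 0 ≤ Cu := (abs_nonneg _).trans (hCu 0)
  have hC₂0 : 0 ≤ C₂ :=
    le_trans (norm_nonneg (fderiv ℝ (fderiv ℝ γ) (0, 0))) (hC₂ 0 (by simp) 0)
  choose! a haC ha using ha
  have hCa0 : 0 ≤ Ca := (abs_nonneg _).trans (haC 0 (by simp) 0)
  set C₁ := Cu + 4 * M + 2 + 4 * M ^ 2 + L * (4 * M + 1)
  have hC₁0 : 0 ≤ C₁ := by positivity
  refine ⟨(C₁ + C₂ * (1 + Ca) ^ 2) * exp L, fun N hN hMN δ hδ x q z h => ?_⟩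
  have hN' : (0 : ℝ) < N := by exact_mod_cast hN
  let σ : ℕ → ℝ := fun k => Nat.rec (x 0) (fun k s => s + 1 / N * a (k / N) s) k
  have hσ : ∀ k, σ (k + 1) = σ k + 1 / N * a (k / N) (σ k) := fun k => rfl
  set p : ℕ → ℝ × ℝ × ℝ := fun k => (x k, q k, z k)
  have hIcc : ∀ k ≤ N, (k / N : ℝ) ∈ Set.Icc (0 : ℝ) 1 := fun k hk =>
    ⟨by positivity, by rw [div_le_one hN']; exact_mod_cast hk⟩
  have hd := le_of_discrete_gronwall (d := fun k => ‖p k - γ (k / N, σ k)‖) hL0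
    (by positivity : 0 ≤ C₁ + C₂ * (1 + Ca) ^ 2) hN
    (by
      have : σ 0 = x 0 := rfl
      simp [p, this, hγ0, h.q_zero, h.z_zero])
    (fun k hk => by
      set X := contactField H (k / N) (γ (k / N, σ k)) with hX
      have h1 := h.euler_step hH hMx hMz hMyz hL hL0 hCu hN hMN hδ hk
      have hv : (((k + 1 : ℕ) / N, σ (k + 1)) : ℝ × ℝ) - ((k / N, σ k) : ℝ × ℝ) =
          (1 / N : ℝ) • (1, a (k / N) (σ k)) := by
        rw [hσ]
        ext
        · simp; ring
        · simp
      have h2 := norm_sub_sub_fderiv_le_of_convex hγ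
        ((convex_Icc (0 : ℝ) 1).prod (convex_univ (E := ℝ) (𝕜 := ℝ))) (L := C₂)
        (fun y hy => hC₂ y.1 hy.1 y.2) (x := (k / N, σ k)) (y := ((k + 1 : ℕ) / N, σ (k + 1)))
        ⟨hIcc k hk.le, trivial⟩ ⟨hIcc (k + 1) hk, trivial⟩
      rw [hv, map_smul, ← ha _ (hIcc k hk.le), norm_smul] at h2
      have h3 : ‖((1, a (k / N) (σ k)) : ℝ × ℝ)‖ ≤ 1 + Ca := by
        rw [Prod.norm_mk, norm_one]
        exact max_le (by linarith) ((haC _ (hIcc k hk.le) _).trans (by linarith))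
      have h4 : C₂ * (‖(1 / N : ℝ)‖ * ‖((1, a (k / N) (σ k)) : ℝ × ℝ)‖) ^ 2 ≤
          C₂ * (1 + Ca) ^ 2 / N ^ 2 := by
        rw [Real.norm_of_nonneg (by positivity)]
        calc _ ≤ C₂ * (1 / N * (1 + Ca)) ^ 2 := by gcongr
          _ = _ := by ring
      have h5 := hL (k / N) (p k) (γ (k / N, σ k))
      have e : p (k + 1) - γ ((k + 1 : ℕ) / N, σ (k + 1)) =
          (p (k + 1) - p k - (1 / N : ℝ) • contactField H (k / N) (p k)) -
          (γ ((k + 1 : ℕ) / N, σ (k + 1)) - γ (k / N, σ k) - (1 / N : ℝ) • X) +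
          ((p k - γ (k / N, σ k)) +
            (1 / N : ℝ) • (contactField H (k / N) (p k) - X)) := by
        rw [smul_sub]; abel
      rw [e]
      refine (norm_add_le _ _).trans ((add_le_add (norm_sub_le _ _) (norm_add_le _ _)).trans ?_)
      rw [norm_smul (1 / N : ℝ) (contactField H (k / N) (p k) - X),
        Real.norm_of_nonneg (by positivity : (0 : ℝ) ≤ 1 / N)]
      have h6 : 1 / (N : ℝ) * ‖contactField H (k / N) (p k) - X‖ ≤
        1 / N * (L * ‖p k - γ (k / N, σ k)‖) := by gcongr
      calc _ ≤ C₁ / N ^ 2 + C₂ * (1 + Ca) ^ 2 / N ^ 2 + (‖p k - γ (k / N, σ k)‖ +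
            1 / N * (L * ‖p k - γ (k / N, σ k)‖)) :=
            add_le_add (add_le_add h1 (h2.trans h4)) (add_le_add le_rfl h6)
        _ = _ := by ring)
  refine ⟨σ N, ?_⟩
  simpa [p, h.x_end, div_self hN'.ne'] using hd

end EulerScheme

section Tangency

/-- The contact Hamiltonian `y ∂ₜx - ∂ₜz` of an isotopy of curves in `ℝ³`. -/
noncomputable def isotopyHamiltonian (γ : ℝ × ℝ → ℝ × ℝ × ℝ) (p : ℝ × ℝ) : ℝ :=
  (γ p).2.1 * (fderiv ℝ γ p (1, 0)).1 - (fderiv ℝ γ p (1, 0)).2.2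

lemma hasDerivAt_fderiv_apply {E F : Type*} [NormedAddCommGroup E] [NormedSpace ℝ E]
    [NormedAddCommGroup F] [NormedSpace ℝ F] {γ : E → F} (hγ : ContDiff ℝ 2 γ) (v : E)
    {c : ℝ → E} {c' : E} {r : ℝ} (hc : HasDerivAt c c' r) :
    HasDerivAt (fun r => fderiv ℝ γ (c r) v) (fderiv ℝ (fderiv ℝ γ) (c r) c' v) r := by
  have hd : ContDiff ℝ 1 (fderiv ℝ γ) := hγ.fderiv_right (by norm_num)
  have hdp := (hd.differentiable one_ne_zero (c r)).hasFDerivAt.comp_hasDerivAt r hc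
  exact (ContinuousLinearMap.apply ℝ F v).hasFDerivAt.comp_hasDerivAt r hdp

lemma HasDerivAt.triple_fst {f : ℝ → ℝ × ℝ × ℝ} {f' : ℝ × ℝ × ℝ} {r : ℝ} (h : HasDerivAt f f' r) :
    HasDerivAt (fun r => (f r).1) f'.1 r :=
  (ContinuousLinearMap.fst ℝ ℝ (ℝ × ℝ)).hasFDerivAt.comp_hasDerivAt r h

lemma HasDerivAt.triple_mid {f : ℝ → ℝ × ℝ × ℝ} {f' : ℝ × ℝ × ℝ} {r : ℝ} (h : HasDerivAt f f' r) :
    HasDerivAt (fun r => (f r).2.1) f'.2.1 r :=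
  ((ContinuousLinearMap.fst ℝ ℝ ℝ).comp
    (ContinuousLinearMap.snd ℝ ℝ (ℝ × ℝ))).hasFDerivAt.comp_hasDerivAt r h

lemma HasDerivAt.triple_last {f : ℝ → ℝ × ℝ × ℝ} {f' : ℝ × ℝ × ℝ} {r : ℝ} (h : HasDerivAt f f' r) :
    HasDerivAt (fun r => (f r).2.2) f'.2.2 r :=
  ((ContinuousLinearMap.snd ℝ ℝ ℝ).comp
    (ContinuousLinearMap.snd ℝ ℝ (ℝ × ℝ))).hasFDerivAt.comp_hasDerivAt r h

/-- Along a Legendrian isotopy, the `s`-derivative of the Hamiltonian. -/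
lemma hasDerivAt_isotopyHamiltonian {γ : ℝ × ℝ → ℝ × ℝ × ℝ} (hγ : ContDiff ℝ 2 γ)
    (hleg : ∀ p, (fderiv ℝ γ p (0, 1)).2.2 = (γ p).2.1 * (fderiv ℝ γ p (0, 1)).1) (t s : ℝ) :
    HasDerivAt (fun s => isotopyHamiltonian γ (t, s))
      ((fderiv ℝ γ (t, s) (0, 1)).2.1 * (fderiv ℝ γ (t, s) (1, 0)).1 -
        (fderiv ℝ γ (t, s) (1, 0)).2.1 * (fderiv ℝ γ (t, s) (0, 1)).1) s := by
  have hsymm : fderiv ℝ (fderiv ℝ γ) (t, s) (0, 1) (1, 0) =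
      fderiv ℝ (fderiv ℝ γ) (t, s) (1, 0) (0, 1) :=
    (hγ.contDiffAt (x := (t, s))).isSymmSndFDerivAt (by simp) _ _
  have hs : HasDerivAt (fun s : ℝ => ((t, s) : ℝ × ℝ)) (0, 1) s :=
    (hasDerivAt_const s t).prodMk (hasDerivAt_id s)
  have ht : HasDerivAt (fun t : ℝ => ((t, s) : ℝ × ℝ)) (1, 0) t :=
    (hasDerivAt_id t).prodMk (hasDerivAt_const t s)
  have hγp := (hγ.differentiable two_ne_zero (t, s)).hasFDerivAt
  have hγs : HasDerivAt (fun s => γ (t, s)) (fderiv ℝ γ (t, s) (0, 1)) s :=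
    hγp.comp_hasDerivAt s hs
  have hγt : HasDerivAt (fun t => γ (t, s)) (fderiv ℝ γ (t, s) (1, 0)) t :=
    hγp.comp_hasDerivAt t ht
  have hds := hasDerivAt_fderiv_apply hγ (1, 0) hs
  have hdt := hasDerivAt_fderiv_apply hγ (0, 1) ht
  rw [hsymm] at hds
  have hlegt := hdt.triple_last.unique ((hγt.triple_mid.mul hdt.triple_fst).congr_of_eventuallyEq
    (.of_forall fun t => hleg (t, s)))
  refine ((hγs.triple_mid.mul hds.triple_fst).sub hds.triple_last).congr_deriv ?_
  rw [hlegt]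
  ring

/-- A contact field whose Hamiltonian extends that of a Legendrian isotopy moves the isotopy up to
reparametrization. -/
lemma exists_contactField_eq_fderiv {γ : ℝ × ℝ → ℝ × ℝ × ℝ} (hγ : ContDiff ℝ 2 γ)
    (himm : ∀ p, fderiv ℝ γ p (0, 1) ≠ 0)
    (hleg : ∀ p, (fderiv ℝ γ p (0, 1)).2.2 = (γ p).2.1 * (fderiv ℝ γ p (0, 1)).1)
    {H : ℝ → ℝ × ℝ × ℝ → ℝ} {t : ℝ} (hH : Differentiable ℝ (H t))
    (hHγ : ∀ s, H t (γ (t, s)) = isotopyHamiltonian γ (t, s)) (s : ℝ) :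
    ∃ a, contactField H t (γ (t, s)) = fderiv ℝ γ (t, s) (1, a) := by
  have hs : HasDerivAt (fun s : ℝ => ((t, s) : ℝ × ℝ)) (0, 1) s :=
    (hasDerivAt_const s t).prodMk (hasDerivAt_id s)
  have hγs : HasDerivAt (fun s => γ (t, s)) (fderiv ℝ γ (t, s) (0, 1)) s :=
    (hγ.differentiable two_ne_zero (t, s)).hasFDerivAt.comp_hasDerivAt s hs
  have hHs := ((hH (γ (t, s))).hasFDerivAt.comp_hasDerivAt s hγs).unique
    ((hasDerivAt_isotopyHamiltonian hγ hleg t s).congr_of_eventuallyEq (.of_forall hHγ))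
  have hlin : ∀ a : ℝ, fderiv ℝ γ (t, s) (1, a) =
      fderiv ℝ γ (t, s) (1, 0) + a • fderiv ℝ γ (t, s) (0, 1) := by
    intro a
    rw [← map_smul, ← map_add]
    simp
  have hlegp := hleg (t, s)
  have himmp := himm (t, s)
  have hHp := hHγ s
  rw [isotopyHamiltonian] at hHp
  suffices h : ∃ a : ℝ, contactField H t (γ (t, s)) =
      fderiv ℝ γ (t, s) (1, 0) + a • fderiv ℝ γ (t, s) (0, 1) from
    h.imp fun a ha => ha.trans (hlin a).symm
  clear hlin
  rw [contactField, hHp]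
  generalize fderiv ℝ γ (t, s) (1, 0) = X at *
  generalize fderiv ℝ γ (t, s) (0, 1) = S at *
  obtain ⟨S₁, S₂, S₃⟩ := S
  obtain ⟨X₁, X₂, X₃⟩ := X
  rw [fderiv_apply_eq_partials] at hHs
  simp only at hHs hlegp
  generalize partialX (H t) (γ (t, s)) = hx at *
  generalize partialY (H t) (γ (t, s)) = hy at *
  generalize partialZ (H t) (γ (t, s)) = hz at *
  generalize (γ (t, s)).2.1 = y at *
  have hpos : S₁ ^ 2 + S₂ ^ 2 ≠ 0 := by
    intro h0
    have h1 : S₁ = 0 := by nlinarith [sq_nonneg S₁, sq_nonneg S₂]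
    have h2 : S₂ = 0 := by nlinarith [sq_nonneg S₁, sq_nonneg S₂]
    exact himmp (by rw [hlegp, h1, h2, mul_zero]; rfl)
  have hpar : (hx + y * hz + X₂) * S₁ + (hy - X₁) * S₂ = 0 := by
    rw [hlegp] at hHs
    linear_combination hHs
  have ha1 : ((hy - X₁) * S₁ + (-(hx + y * hz) - X₂) * S₂) / (S₁ ^ 2 + S₂ ^ 2) * S₁ = hy - X₁ := by
    field_simp
    linear_combination (-S₂) * hpar
  have ha2 : ((hy - X₁) * S₁ + (-(hx + y * hz) - X₂) * S₂) / (S₁ ^ 2 + S₂ ^ 2) * S₂ =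
      -(hx + y * hz) - X₂ := by
    field_simp
    linear_combination S₁ * hpar
  refine ⟨((hy - X₁) * S₁ + (-(hx + y * hz) - X₂) * S₂) / (S₁ ^ 2 + S₂ ^ 2), ?_⟩
  simp only [Prod.smul_mk, Prod.mk_add_mk, smul_eq_mul, hlegp, Prod.mk.injEq]
  generalize ((hy - X₁) * S₁ + (-(hx + y * hz) - X₂) * S₂) / (S₁ ^ 2 + S₂ ^ 2) = a at *
  exact ⟨by linear_combination -ha1, by linear_combination -ha2, by linear_combination (-y) * ha1⟩

end Tangency

section Extension

open Set Filter Topology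
open scoped ContDiff Manifold

variable {G : Type*} [NormedAddCommGroup G]

/-- The space-time trace over a compact parameter interval of a family of curves is closed. -/
lemma isClosed_image_trace {c : ℝ × ℝ → G} (hc : Continuous c) {A : Set (ℝ × ℝ)} (hA : IsClosed A)
    (a b : ℝ) : IsClosed ((fun q : ℝ × ℝ => (q.1, c q)) '' (A ∩ univ ×ˢ Icc a b)) := by
  have hclosed : IsClosed {r : Icc a b × ℝ × G | (r.2.1, (r.1 : ℝ)) ∈ A ∧
      c (r.2.1, (r.1 : ℝ)) = r.2.2} := by
    apply IsClosed.inter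
    · exact hA.preimage (by fun_prop)
    · exact isClosed_eq (by fun_prop) (by fun_prop)
  convert! isClosedMap_snd_of_compactSpace _ hclosed
  ext ⟨t, p⟩
  constructor
  · rintro ⟨⟨t', s⟩, ⟨hA, -, hs⟩, h⟩
    obtain ⟨rfl, rfl⟩ := Prod.mk.inj h
    exact ⟨(⟨s, hs⟩, t', c (t', s)), ⟨hA, rfl⟩, rfl⟩
  · rintro ⟨⟨s, t', p'⟩, ⟨hA, hp⟩, h⟩
    obtain ⟨rfl, rfl⟩ := Prod.mk.inj h
    exact ⟨(t', s), ⟨hA, trivial, s.2⟩, Prod.ext rfl hp⟩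

variable [NormedSpace ℝ G]

/-- The space-time trace of a family of immersed curves has a local inverse which extends to a
smooth function on an open set. -/
lemma exists_contDiffAt_leftInverse_trace {c : ℝ × ℝ → G} {n : WithTop ℕ∞} (hn : n ≠ 0)
    (hc : ContDiff ℝ n c) {q₀ : ℝ × ℝ} (hq₀ : fderiv ℝ c q₀ (0, 1) ≠ 0) :
    ∃ ψ : ℝ × G → ℝ × ℝ, ContDiffAt ℝ n ψ (q₀.1, c q₀) ∧
      ∀ᶠ q in 𝓝 q₀, ψ (q.1, c q) = q := by
  obtain ⟨ℓ, -, hℓ⟩ := exists_dual_vector ℝ (fderiv ℝ c q₀ (0, 1)) (norm_ne_zero_iff.2 hq₀)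
  have hℓ0 : ℓ (fderiv ℝ c q₀ (0, 1)) ≠ 0 := by
    rw [hℓ]
    simpa using hq₀
  set D : ℝ × ℝ →L[ℝ] ℝ × ℝ :=
    (ContinuousLinearMap.fst ℝ ℝ ℝ).prod (ℓ.comp (fderiv ℝ c q₀)) with hD
  have hinj : Function.Injective D := by
    rw [injective_iff_map_eq_zero]
    rintro ⟨a, b⟩ hab
    obtain ⟨ha, hb⟩ := Prod.mk.inj hab
    obtain rfl : a = 0 := ha
    have : ((0 : ℝ), b) = b • ((0 : ℝ), (1 : ℝ)) := by simp
    change ℓ (fderiv ℝ c q₀ (0, b)) = 0 at hb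
    rw [this, map_smul, map_smul, smul_eq_mul, mul_eq_zero, or_iff_left hℓ0] at hb
    rw [hb]
    rfl
  let e : (ℝ × ℝ) ≃L[ℝ] ℝ × ℝ :=
    (LinearEquiv.ofInjectiveEndo D.toLinearMap hinj).toContinuousLinearEquiv
  set Φ : ℝ × ℝ → ℝ × ℝ := fun q => (q.1, ℓ (c q)) with hΦ
  have hΦn : ContDiffAt ℝ n Φ q₀ := (contDiff_fst.prodMk (ℓ.contDiff.comp hc)).contDiffAt
  have hΦe : HasFDerivAt Φ (e : ℝ × ℝ →L[ℝ] ℝ × ℝ) q₀ := by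
    have : (e : ℝ × ℝ →L[ℝ] ℝ × ℝ) = D := by ext <;> rfl
    rw [this]
    exact hasFDerivAt_fst.prodMk
      (ℓ.hasFDerivAt.comp q₀ (hc.differentiable hn q₀).hasFDerivAt)
  refine ⟨fun p => hΦn.localInverse hΦe hn (p.1, ℓ p.2), ?_, ?_⟩
  · have := hΦn.to_localInverse hΦe hn
    exact ContDiffAt.comp (q₀.1, c q₀) this
      (contDiff_fst.prodMk (ℓ.contDiff.comp contDiff_snd)).contDiffAt
  · exact (hΦn.hasStrictFDerivAt' hΦe hn).eventually_left_inverse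

/-- Functions prescribed along a disjoint family of smoothly varying embedded closed curves extend
to the ambient space. -/
theorem exists_contDiff_extension_of_closed_curves [FiniteDimensional ℝ G] {ι : Type*} [Finite ι]
    {T : ℝ} (hT : 0 < T) {c : ι → ℝ × ℝ → G} (hc : ∀ i, ContDiff ℝ 2 (c i))
    (hcT : ∀ i t s, c i (t, s + T) = c i (t, s)) (himm : ∀ i q, fderiv ℝ (c i) q (0, 1) ≠ 0)
    (hinj : ∀ i j t s s', c i (t, s) = c j (t, s') → i = j ∧ ∃ k : ℤ, s - s' = T * k)
    {K : ι → ℝ × ℝ → ℝ} (hK : ∀ i, ContDiff ℝ 2 (K i))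
    (hKT : ∀ i t s, K i (t, s + T) = K i (t, s)) :
    ∃ F : ℝ × G → ℝ, ContDiff ℝ 2 F ∧ ∀ i q, F (q.1, c i q) = K i q := by
  have hshift : ∀ i t s a, ∃ s' ∈ Icc a (a + T), c i (t, s) = c i (t, s') ∧
      K i (t, s) = K i (t, s') := by
    intro i t s a
    obtain ⟨m, hm, -⟩ := existsUnique_add_zsmul_mem_Ico hT s a
    have hc' : Function.Periodic (fun s => c i (t, s)) T := hcT i t
    have hK' : Function.Periodic (fun s => K i (t, s)) T := hKT i t
    exact ⟨_, Ico_subset_Icc_self hm, ((hc'.zsmul m) s).symm, ((hK'.zsmul m) s).symm⟩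
  have hconv : ∀ p : ℝ × G, Convex ℝ {v : ℝ | ∀ i q, (q.1, c i q) = p → v = K i q} := by
    intro p
    simp only [ofPred_forall]
    exact convex_iInter fun i => convex_iInter fun q => convex_iInter fun _ =>
      convex_singleton (K i q)
  have hloc : ∀ p : ℝ × G, ∃ U ∈ 𝓝 p, ∃ f : ℝ × G → ℝ,
      ContMDiffOn 𝓘(ℝ, ℝ × G) 𝓘(ℝ, ℝ) (2 : ℕ∞) f U ∧
        ∀ y ∈ U, f y ∈ {v : ℝ | ∀ i q, (q.1, c i q) = y → v = K i q} := by
    intro p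
    by_cases hp : ∃ i q, (q.1, c i q) = p
    · obtain ⟨i, ⟨t₀, s₀⟩, rfl⟩ := hp
      obtain ⟨ψ, hψ, hψinv⟩ :=
        exists_contDiffAt_leftInverse_trace two_ne_zero (hc i) (himm i (t₀, s₀))
      obtain ⟨W, hWsub, hWopen, hW⟩ := mem_nhds_iff.1 hψinv
      have hKψ : ContDiffAt ℝ 2 (K i ∘ ψ) (t₀, c i (t₀, s₀)) :=
        ContDiffAt.comp _ (hK i).contDiffAt hψ
      obtain ⟨V, hV, hVψ⟩ := hKψ.contDiffOn le_rfl (by simp)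
      set A : ι → Set (ℝ × ℝ) := fun j => {q | j = i → q ∉ W} with hA
      have hAclosed : ∀ j, IsClosed (A j) := by
        intro j
        by_cases hj : j = i
        · have : A j = Wᶜ := by ext; simp [hA, hj]
          rw [this]
          exact hWopen.isClosed_compl
        · have : A j = univ := by ext; simp [hA, hj]
          rw [this]
          exact isClosed_univ
      set Z : Set (ℝ × G) := ⋃ j, (fun q : ℝ × ℝ => (q.1, c j q)) ''
        (A j ∩ univ ×ˢ Icc (s₀ - T / 2) (s₀ - T / 2 + T)) with hZ
      have hZclosed : IsClosed Z :=
        isClosed_iUnion_of_finite fun j => isClosed_image_trace (hc j).continuous (hAclosed j) _ _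
      have hpZ : (t₀, c i (t₀, s₀)) ∉ Z := by
        intro hmem
        obtain ⟨j, ⟨t, s⟩, ⟨hAj, -, hs⟩, h⟩ := mem_iUnion.1 hmem
        obtain ⟨ht, hcs⟩ := Prod.mk.inj h
        obtain rfl : t = t₀ := ht
        obtain ⟨rfl, k, hk⟩ := hinj _ _ _ _ _ hcs
        have hk0 : k = 0 := by
          have h1 : (k : ℝ) < 1 := by
            by_contra! hge
            nlinarith [hs.2]
          have h2 : (-1 : ℝ) < k := by
            by_contra! hle
            nlinarith [hs.1]
          have h1' : k < 1 := by exact_mod_cast h1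
          have h2' : -1 < k := by exact_mod_cast h2
          omega
        have hss : s = s₀ := by
          rw [hk0] at hk
          simpa [sub_eq_zero] using hk
        exact hAj rfl (hss ▸ hW)
      refine ⟨V ∩ Zᶜ, inter_mem hV (hZclosed.isOpen_compl.mem_nhds hpZ), K i ∘ ψ,
        (hVψ.mono inter_subset_left).contMDiffOn, ?_⟩
      rintro y ⟨-, hyZ⟩ j ⟨t, s⟩ rfl
      obtain ⟨s', hs', hcs', hKs'⟩ := hshift j t s (s₀ - T / 2)
      have hnA : (t, s') ∉ A j := fun hAj =>
        hyZ (mem_iUnion.2 ⟨j, (t, s'), ⟨hAj, trivial, hs'⟩, Prod.ext rfl hcs'.symm⟩)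
      simp only [hA, mem_ofPred_eq, Classical.not_imp, not_not] at hnA
      obtain ⟨rfl, hsW⟩ := hnA
      have hψs : ψ (t, c j (t, s')) = (t, s') := hWsub hsW
      rw [Function.comp_apply, hcs', hψs, hKs']
    · set Z : Set (ℝ × G) := ⋃ j, (fun q : ℝ × ℝ => (q.1, c j q)) ''
        (univ ∩ univ ×ˢ Icc 0 (0 + T)) with hZ
      have hZclosed : IsClosed Z :=
        isClosed_iUnion_of_finite fun j => isClosed_image_trace (hc j).continuous isClosed_univ _ _
      have hpZ : p ∉ Z := by
        intro hmem
        obtain ⟨j, q, -, h⟩ := mem_iUnion.1 hmem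
        exact hp ⟨j, q, h⟩
      refine ⟨Zᶜ, hZclosed.isOpen_compl.mem_nhds hpZ, fun _ => 0, contMDiffOn_const, ?_⟩
      rintro y hyZ j ⟨t, s⟩ rfl
      obtain ⟨s', hs', hcs', -⟩ := hshift j t s 0
      exact (hyZ (mem_iUnion.2
        ⟨j, (t, s'), ⟨trivial, trivial, hs'⟩, Prod.ext rfl hcs'.symm⟩)).elim
  obtain ⟨F, hF⟩ := exists_contMDiffMap_forall_mem_convex_of_local 𝓘(ℝ, ℝ × G) hconv hloc
  exact ⟨F, F.contMDiff.contDiff, fun i q => hF _ i q rfl⟩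

end Extension

section Hamiltonian

open Set Filter Topology

/-- A continuous family of closed curves is bounded on the unit time interval. -/
lemma exists_norm_le_of_periodic_snd {E : Type*} [NormedAddCommGroup E] {f : ℝ × ℝ → E}
    (hf : Continuous f) {T : ℝ} (hT : 0 < T) (hfT : ∀ t s, f (t, s + T) = f (t, s)) :
    ∃ C, ∀ t ∈ Icc (0 : ℝ) 1, ∀ s, ‖f (t, s)‖ ≤ C := by
  obtain ⟨C, hC⟩ := (isCompact_Icc (a := (0 : ℝ)) (b := 1) |>.prod
    (isCompact_Icc (a := (0 : ℝ)) (b := 0 + T))).exists_bound_of_continuousOn hf.continuousOn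
  refine ⟨C, fun t ht s => ?_⟩
  obtain ⟨m, hm, -⟩ := existsUnique_add_zsmul_mem_Ico hT s 0
  have hper : Function.Periodic (fun s => f (t, s)) T := hfT t
  have := hC (t, s + m • T) ⟨ht, Ico_subset_Icc_self hm⟩
  rwa [show f (t, s + m • T) = f (t, s) from hper.zsmul m s] at this

/-- Translation equivariance passes to a genuine periodicity of the derivative. -/
lemma fderiv_add_eq_of_equivariant {E F : Type*} [NormedAddCommGroup E] [NormedSpace ℝ E]
    [NormedAddCommGroup F] [NormedSpace ℝ F] {f : E → F} {v : E} {w : F}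
    (hf : ∀ p, f (p + v) = f p + w) (p : E) : fderiv ℝ f (p + v) = fderiv ℝ f p := by
  rw [← fderiv_comp_add_right, show (fun x => f (x + v)) = fun x => f x + w from funext hf,
    fderiv_add_const]

/-- The embedding of `J¹(S¹)` into `ℝ⁴`, on the universal cover. -/
noncomputable def jetEmbedding (p : ℝ × ℝ × ℝ) : ℝ × ℝ × ℝ × ℝ := (cos p.1, sin p.1, p.2.1, p.2.2)

lemma contDiff_jetEmbedding {n : WithTop ℕ∞} : ContDiff ℝ n jetEmbedding := by
  unfold jetEmbedding
  fun_prop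

lemma jetEmbedding_add (p : ℝ × ℝ × ℝ) : jetEmbedding (p + (2 * π, 0, 0)) = jetEmbedding p := by
  simp [jetEmbedding]

lemma exists_int_of_jetEmbedding_eq {p p' : ℝ × ℝ × ℝ} (h : jetEmbedding p = jetEmbedding p') :
    ∃ k : ℤ, p = p' + (2 * π * k, 0, 0) := by
  simp only [jetEmbedding, Prod.mk.injEq] at h
  obtain ⟨hcos, hsin, hy, hz⟩ := h
  obtain ⟨k, hk⟩ := Real.Angle.angle_eq_iff_two_pi_dvd_sub.1 (Real.Angle.cos_sin_inj hcos hsin)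
  refine ⟨k, Prod.ext ?_ (Prod.ext ?_ ?_)⟩
  · simp only [Prod.fst_add]
    linarith
  · simpa using hy
  · simpa using hz

lemma fderiv_jetEmbedding_ne_zero (p : ℝ × ℝ × ℝ) {v : ℝ × ℝ × ℝ} (hv : v ≠ 0) :
    fderiv ℝ jetEmbedding p v ≠ 0 := by
  have hfst : HasFDerivAt (fun p : ℝ × ℝ × ℝ => p.1) (ContinuousLinearMap.fst ℝ ℝ (ℝ × ℝ)) p :=
    hasFDerivAt_fst
  have hsnd : HasFDerivAt (fun p : ℝ × ℝ × ℝ => p.2) (ContinuousLinearMap.snd ℝ ℝ (ℝ × ℝ)) p :=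
    hasFDerivAt_snd
  have hd : HasFDerivAt jetEmbedding _ p := hfst.cos.prodMk (hfst.sin.prodMk hsnd)
  rw [hd.fderiv]
  intro h
  apply hv
  obtain ⟨a, b⟩ := v
  simp only [ContinuousLinearMap.prod_apply, _root_.smul_apply,
    ContinuousLinearMap.coe_fst', ContinuousLinearMap.coe_snd', smul_eq_mul,
    Prod.mk_eq_zero] at h
  obtain ⟨h1, h2, rfl⟩ := h
  have ha : a = 0 := by
    linear_combination (-sin p.1) * h1 + cos p.1 * h2 - a * sin_sq_add_cos_sq p.1
  rw [ha]
  rfl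

/-- A disjoint family of embedded equivariant isotopies is driven by a compactly supported
Hamiltonian on `J¹(S¹)`. -/
theorem exists_hamiltonian_of_isotopies {ι : Type*} [Finite ι] {γ : ι → ℝ × ℝ → ℝ × ℝ × ℝ}
    (hγ : ∀ i, ContDiff ℝ 3 (γ i)) (hper : ∀ i t s, γ i (t, s + 2 * π) = γ i (t, s) + (2 * π, 0, 0))
    (himm : ∀ i q, fderiv ℝ (γ i) q (0, 1) ≠ 0)
    (hinj : ∀ i j t s s', γ i (t, s) = γ j (t, s') → i = j ∧ ∃ k : ℤ, s - s' = 2 * π * k) :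
    ∃ H : ℝ × ℝ × ℝ × ℝ → ℝ, ContDiff ℝ 2 H ∧ (∀ p, H (p + (0, 2 * π, 0, 0)) = H p) ∧
      (∃ R, ∀ p, R < ‖(p.1, p.2.2)‖ → H p = 0) ∧
      ∀ i, ∀ t ∈ Icc (0 : ℝ) 1, ∀ s, H (t, γ i (t, s)) = isotopyHamiltonian (γ i) (t, s) := by
  set c : ι → ℝ × ℝ → ℝ × ℝ × ℝ × ℝ := fun i => jetEmbedding ∘ γ i with hc
  have hcn : ∀ i, ContDiff ℝ 2 (c i) := fun i =>
    contDiff_jetEmbedding.comp ((hγ i).of_le (by norm_num))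
  have hcT : ∀ i t s, c i (t, s + 2 * π) = c i (t, s) := by
    intro i t s
    simp only [hc, Function.comp_apply, hper, jetEmbedding_add]
  have hcimm : ∀ i q, fderiv ℝ (c i) q (0, 1) ≠ 0 := by
    intro i q
    rw [hc, fderiv_comp _ (contDiff_jetEmbedding.differentiable one_ne_zero _)
      ((hγ i).differentiable (by norm_num) _)]
    exact fderiv_jetEmbedding_ne_zero _ (himm i q)
  have hperk : ∀ i t s (k : ℤ), γ i (t, s + 2 * π * k) = γ i (t, s) + (2 * π * k, 0, 0) := by
    intro i t s k
    have hp : Function.Periodic (fun s => γ i (t, s) - (s, 0, 0)) (2 * π) := by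
      intro s
      simp only [hper]
      ext <;> simp
    have := hp.int_mul k s
    rw [mul_comm (2 * π), eq_add_of_sub_eq this]
    ext
    · simp only [Prod.fst_add, Prod.fst_sub]
      ring
    · simp
    · simp
  have hcinj : ∀ i j t s s', c i (t, s) = c j (t, s') → i = j ∧ ∃ k : ℤ, s - s' = 2 * π * k := by
    intro i j t s s' h
    obtain ⟨m, hm⟩ := exists_int_of_jetEmbedding_eq h
    rw [← hperk] at hm
    obtain ⟨hij, k, hk⟩ := hinj _ _ _ _ _ hm
    refine ⟨hij, k + m, ?_⟩
    push_cast
    linear_combination hk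
  have hfper : ∀ i t s, fderiv ℝ (γ i) (t, s + 2 * π) = fderiv ℝ (γ i) (t, s) := by
    intro i t s
    have := fderiv_add_eq_of_equivariant (f := γ i) (v := (0, 2 * π)) (w := (2 * π, 0, 0))
      (by rintro ⟨t, s⟩; simpa using hper i t s) (t, s)
    simpa using this
  have hK : ∀ i, ContDiff ℝ 2 (isotopyHamiltonian (γ i)) := by
    intro i
    have h2 : ContDiff ℝ 2 (γ i) := (hγ i).of_le (by norm_num)
    have hd : ContDiff ℝ 2 (fun q => fderiv ℝ (γ i) q (1, 0)) :=
      ((hγ i).fderiv_right (by norm_num)).clm_apply contDiff_const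
    unfold isotopyHamiltonian
    fun_prop
  have hKT : ∀ i t s, isotopyHamiltonian (γ i) (t, s + 2 * π) =
      isotopyHamiltonian (γ i) (t, s) := by
    intro i t s
    simp only [isotopyHamiltonian, hfper, hper]
    simp
  obtain ⟨F, hF, hFK⟩ := exists_contDiff_extension_of_closed_curves two_pi_pos hcn hcT hcimm hcinj
    hK hKT
  have hbound : ∀ i, ∃ C, ∀ t ∈ Icc (0 : ℝ) 1, ∀ s, ‖c i (t, s)‖ ≤ C := fun i =>
    exists_norm_le_of_periodic_snd (hcn i).continuous two_pi_pos (hcT i)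
  choose C hC using hbound
  obtain ⟨B, hB⟩ := (Set.finite_range C).bddAbove
  have hB' : ∀ i, C i ≤ B := fun i => hB ⟨i, rfl⟩
  let χ : ContDiffBump (0 : ℝ × ℝ × ℝ × ℝ × ℝ) :=
    ⟨max B 1, max B 1 + 1, lt_max_of_lt_right one_pos, by linarith⟩
  have he : ContDiff ℝ 2 (fun p : ℝ × ℝ × ℝ × ℝ => (p.1, jetEmbedding p.2)) :=
    contDiff_fst.prodMk (contDiff_jetEmbedding.comp contDiff_snd)
  refine ⟨fun p => χ (p.1, jetEmbedding p.2) * F (p.1, jetEmbedding p.2),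
    (χ.contDiff.comp he).mul (hF.comp he), ?_, ⟨max B 1 + 1, ?_⟩, ?_⟩
  · rintro ⟨t, p⟩
    have : jetEmbedding (p + (2 * π, 0, 0)) = jetEmbedding p := jetEmbedding_add p
    simp only [Prod.mk_add_mk, add_zero, this]
  · intro p hp
    have hle : ‖(p.1, p.2.2)‖ ≤ ‖(p.1, jetEmbedding p.2)‖ := by
      simp only [jetEmbedding, Prod.norm_def]
      refine max_le (le_max_left _ _) ((le_max_of_le_right ?_).trans (le_max_right _ _))
      exact le_max_of_le_right le_rfl
    have : χ (p.1, jetEmbedding p.2) = 0 := by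
      apply χ.zero_of_le_dist
      rw [dist_zero_right]
      exact hp.le.trans hle
    simp only [this, zero_mul]
  · intro i t ht s
    have : χ (t, jetEmbedding (γ i (t, s))) = 1 := by
      apply χ.one_of_mem_closedBall
      rw [mem_closedBall_zero_iff]
      refine max_le ?_ ((hC i t ht s).trans ((hB' i).trans (le_max_left _ _)))
      refine le_trans ?_ (le_max_right _ _)
      rw [Real.norm_eq_abs, abs_of_nonneg ht.1]
      exact ht.2
    simp only [this, one_mul]
    exact hFK i (t, s)

end Hamiltonian

section Bounds

open Set Filter Topology

/-- Functions of `(t, x, y, z)` that are `2π`-periodic in `x` and compactly supported in the other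
variables. -/
structure IsPeriodicCompactSupport {E : Type*} [Zero E] (f : ℝ × ℝ × ℝ × ℝ → E) : Prop where
  periodic : ∀ p, f (p + (0, 2 * π, 0, 0)) = f p
  support : ∃ R, ∀ p, R < ‖(p.1, p.2.2)‖ → f p = 0

variable {E : Type*} [NormedAddCommGroup E]

lemma IsPeriodicCompactSupport.exists_norm_le {f : ℝ × ℝ × ℝ × ℝ → E}
    (hf : IsPeriodicCompactSupport f) (hcont : Continuous f) : ∃ C, ∀ p, ‖f p‖ ≤ C := by
  obtain ⟨R, hR⟩ := hf.support
  obtain ⟨C, hC⟩ := ((isCompact_closedBall (0 : ℝ) R).prod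
    ((isCompact_Icc (a := (0 : ℝ)) (b := 0 + 2 * π)).prod
      (isCompact_closedBall (0 : ℝ × ℝ) R))).exists_bound_of_continuousOn hcont.continuousOn
  refine ⟨max C 0, ?_⟩
  rintro ⟨t, x, w⟩
  by_cases hp : R < ‖(t, w)‖
  · rw [hR (t, x, w) hp, norm_zero]
    exact le_max_right _ _
  · obtain ⟨m, hm, -⟩ := existsUnique_add_zsmul_mem_Ico two_pi_pos x 0
    have hper : Function.Periodic (fun x => f (t, x, w)) (2 * π) := by
      intro x
      have := hf.periodic (t, x, w)
      rwa [show (t, x, w) + (0, 2 * π, 0, 0) = (t, x + 2 * π, w) by ext <;> simp] at this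
    have hmem := hC (t, x + m • (2 * π), w) ⟨?_, Ico_subset_Icc_self hm, ?_⟩
    · rw [show f (t, x + m • (2 * π), w) = f (t, x, w) from hper.zsmul m x] at hmem
      exact hmem.trans (le_max_left _ _)
    · rw [mem_closedBall_zero_iff]
      exact (le_max_left _ _).trans (not_lt.1 hp)
    · rw [mem_closedBall_zero_iff]
      exact (le_max_right _ _).trans (not_lt.1 hp)

lemma IsPeriodicCompactSupport.fderiv [NormedSpace ℝ E] {f : ℝ × ℝ × ℝ × ℝ → E}
    (hf : IsPeriodicCompactSupport f) : IsPeriodicCompactSupport (fderiv ℝ f) := by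
  obtain ⟨R, hR⟩ := hf.support
  refine ⟨fun p => ?_, R, fun p hp => ?_⟩
  · exact fderiv_add_eq_of_equivariant (w := 0) (fun p => by rw [hf.periodic, add_zero]) p
  · have hev : f =ᶠ[𝓝 p] fun _ => 0 := by
      have hopen : IsOpen {p : ℝ × ℝ × ℝ × ℝ | R < ‖(p.1, p.2.2)‖} :=
        isOpen_lt continuous_const (by fun_prop)
      filter_upwards [hopen.mem_nhds hp] with q hq using hR q hq
    rw [hev.fderiv_eq]
    simp

/-- Spatial derivatives of a function on space-time. -/
lemma fderiv_slice_apply {H : ℝ × ℝ × ℝ × ℝ → ℝ} (hH : Differentiable ℝ H) (t : ℝ)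
    (p v : ℝ × ℝ × ℝ) : fderiv ℝ (fun p => H (t, p)) p v = fderiv ℝ H (t, p) (0, v) := by
  have hp : HasFDerivAt (fun p : ℝ × ℝ × ℝ => (t, p))
      (ContinuousLinearMap.inr ℝ ℝ (ℝ × ℝ × ℝ)) p := hasFDerivAt_prodMk_right t p
  have := (hH (t, p)).hasFDerivAt.comp p hp
  rw [show (fun p => H (t, p)) = H ∘ fun p => (t, p) from rfl, this.fderiv]
  rfl

/-- The contact field of a periodic, compactly supported Hamiltonian is bounded and Lipschitz. -/
theorem IsPeriodicCompactSupport.exists_contactField_bounds {H : ℝ × ℝ × ℝ × ℝ → ℝ}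
    (hH : IsPeriodicCompactSupport H) (hH2 : ContDiff ℝ 2 H) :
    ∃ M L : ℝ, 0 ≤ L ∧ (∀ t p, |partialX (fun p => H (t, p)) p| ≤ M) ∧
      (∀ t p, |partialY (fun p => H (t, p)) p| ≤ M) ∧
      (∀ t p, |partialZ (fun p => H (t, p)) p| ≤ M) ∧
      (∀ t p, |p.2.1 * partialZ (fun p => H (t, p)) p| ≤ M) ∧
      (∀ t p, ‖contactField (fun t p => H (t, p)) t p‖ ≤ M) ∧
      ∀ t p p', ‖contactField (fun t p => H (t, p)) t p -
        contactField (fun t p => H (t, p)) t p'‖ ≤ L * ‖p - p'‖ := by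
  have hdiff := hH2.differentiable two_ne_zero
  have hd1 : ContDiff ℝ 1 (_root_.fderiv ℝ H) := hH2.fderiv_right (by norm_num)
  have hdir : ∀ v, ContDiff ℝ 1 (fun p => _root_.fderiv ℝ H p v) := fun v =>
    hd1.clm_apply contDiff_const
  have hdper := hH.fderiv
  have hdp : ∀ v, IsPeriodicCompactSupport (fun p => _root_.fderiv ℝ H p v) := by
    intro v
    obtain ⟨R, hR⟩ := hdper.support
    exact ⟨fun p => by rw [hdper.periodic], R, fun p hp => by rw [hR p hp]; rfl⟩
  have hyz : IsPeriodicCompactSupport (fun p : ℝ × ℝ × ℝ × ℝ =>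
      p.2.2.1 * _root_.fderiv ℝ H p (0, 0, 0, 1)) := by
    obtain ⟨R, hR⟩ := hdper.support
    exact ⟨fun p => by rw [hdper.periodic]; simp, R, fun p hp => by rw [hR p hp]; simp⟩
  set X : ℝ × ℝ × ℝ × ℝ → ℝ × ℝ × ℝ := fun p => (_root_.fderiv ℝ H p (0, 0, 1, 0),
    -(_root_.fderiv ℝ H p (0, 1, 0, 0) + p.2.2.1 * _root_.fderiv ℝ H p (0, 0, 0, 1)),
    p.2.2.1 * _root_.fderiv ℝ H p (0, 0, 1, 0) - H p) with hX
  have hXp : IsPeriodicCompactSupport X := by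
    obtain ⟨R, hR⟩ := hdper.support
    obtain ⟨R', hR'⟩ := hH.support
    refine ⟨fun p => ?_, max R R', fun p hp => ?_⟩
    · simp only [hX, hdper.periodic, hH.periodic]
      simp
    · simp only [hX, hR p (lt_of_le_of_lt (le_max_left _ _) hp),
        hR' p (lt_of_le_of_lt (le_max_right _ _) hp)]
      simp
  have hX1 : ContDiff ℝ 1 X := by
    have h1 := hdir (0, 1, 0, 0)
    have h2 := hdir (0, 0, 1, 0)
    have h3 := hdir (0, 0, 0, 1)
    have h4 : ContDiff ℝ 1 H := hH2.of_le (by norm_num)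
    fun_prop
  have hXc : ∀ t p, contactField (fun t p => H (t, p)) t p = X (t, p) := by
    intro t p
    simp only [contactField, partialX, partialY, partialZ, fderiv_slice_apply hdiff, hX]
  obtain ⟨A, hA⟩ := (hdp (0, 1, 0, 0)).exists_norm_le (hdir _).continuous
  obtain ⟨B, hB⟩ := (hdp (0, 0, 1, 0)).exists_norm_le (hdir _).continuous
  obtain ⟨C, hC⟩ := (hdp (0, 0, 0, 1)).exists_norm_le (hdir _).continuous
  obtain ⟨D, hD⟩ := hyz.exists_norm_le (by have := (hdir (0, 0, 0, 1)).continuous; fun_prop)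
  obtain ⟨V, hV⟩ := hXp.exists_norm_le hX1.continuous
  obtain ⟨L, hL⟩ := hXp.fderiv.exists_norm_le (hX1.continuous_fderiv one_ne_zero)
  have hA0 := (norm_nonneg _).trans (hA 0)
  have hB0 := (norm_nonneg _).trans (hB 0)
  have hC0 := (norm_nonneg _).trans (hC 0)
  have hD0 := (norm_nonneg _).trans (hD 0)
  have hV0 := (norm_nonneg _).trans (hV 0)
  refine ⟨A + B + C + D + V, L, (norm_nonneg _).trans (hL 0), fun t p => ?_, fun t p => ?_,
    fun t p => ?_, fun t p => ?_, fun t p => ?_, fun t p p' => ?_⟩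
  · rw [partialX, fderiv_slice_apply hdiff]
    exact (hA (t, p)).trans (by linarith)
  · rw [partialY, fderiv_slice_apply hdiff]
    exact (hB (t, p)).trans (by linarith)
  · rw [partialZ, fderiv_slice_apply hdiff]
    exact (hC (t, p)).trans (by linarith)
  · rw [partialZ, fderiv_slice_apply hdiff]
    exact (hD (t, p)).trans (by linarith)
  · rw [hXc]
    exact (hV (t, p)).trans (by linarith)
  · rw [hXc, hXc]
    have := convex_univ.norm_image_sub_le_of_norm_fderiv_le (𝕜 := ℝ) (f := X) (C := L)
      (fun q _ => hX1.differentiable one_ne_zero q) (fun q _ => hL q) (mem_univ (t, p'))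
      (mem_univ (t, p))
    simpa [Prod.norm_def] using this

end Bounds

section Endpoints

open Set Filter Topology

lemma exists_abs_deriv_le_of_periodic {u : ℝ → ℝ} (hu : ContDiff ℝ 1 u)
    (hper : ∀ x, u (x + 2 * π) = u x) : ∃ C, ∀ x, |deriv u x| ≤ C := by
  have hd : Function.Periodic (deriv u) (2 * π) := by
    intro x
    rw [← deriv_comp_add_const, show (fun x => u (x + 2 * π)) = u from funext hper]
  obtain ⟨C, hC⟩ := exists_norm_le_of_periodic_snd (f := fun q : ℝ × ℝ => deriv u q.2)
    ((hu.continuous_deriv le_rfl).comp continuous_snd) two_pi_pos fun _ s => hd s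
  exact ⟨C, fun x => hC 0 (by simp) x⟩

/-- The reparametrization speed of a Legendrian isotopy driven by a bounded contact field is
bounded. -/
lemma exists_bound_contactField_eq_fderiv {γ : ℝ × ℝ → ℝ × ℝ × ℝ} (hγ : ContDiff ℝ 2 γ)
    (hper : ∀ p, γ (p + (0, 2 * π)) = γ p + (2 * π, 0, 0))
    (himm : ∀ p, fderiv ℝ γ p (0, 1) ≠ 0)
    (hleg : ∀ p, (fderiv ℝ γ p (0, 1)).2.2 = (γ p).2.1 * (fderiv ℝ γ p (0, 1)).1)
    {H : ℝ → ℝ × ℝ × ℝ → ℝ} (hH : ∀ t, Differentiable ℝ (H t)) {M : ℝ}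
    (hM : ∀ t p, ‖contactField H t p‖ ≤ M)
    (hHγ : ∀ t ∈ Icc (0 : ℝ) 1, ∀ s, H t (γ (t, s)) = isotopyHamiltonian γ (t, s)) :
    ∃ C, ∀ t ∈ Icc (0 : ℝ) 1, ∀ s, ∃ a, |a| ≤ C ∧
      contactField H t (γ (t, s)) = fderiv ℝ γ (t, s) (1, a) := by
  have hcont : Continuous (fderiv ℝ γ) := hγ.continuous_fderiv two_ne_zero
  have hdper : ∀ t s, fderiv ℝ γ (t, s + 2 * π) = fderiv ℝ γ (t, s) := by
    intro t s
    simpa using fderiv_add_eq_of_equivariant hper (t, s)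
  obtain ⟨B, hB⟩ := exists_norm_le_of_periodic_snd (f := fun p => fderiv ℝ γ p (1, 0))
    (by fun_prop) two_pi_pos (fun t s => by rw [hdper])
  obtain ⟨D, hD⟩ := exists_norm_le_of_periodic_snd (f := fun p => ‖fderiv ℝ γ p (0, 1)‖⁻¹)
    (Continuous.inv₀ (by fun_prop) fun p => norm_ne_zero_iff.2 (himm p)) two_pi_pos
    (fun t s => by rw [hdper])
  refine ⟨(M + B) * D, fun t ht s => ?_⟩
  obtain ⟨a, ha⟩ := exists_contactField_eq_fderiv hγ himm hleg (hH t) (hHγ t ht) s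
  refine ⟨a, ?_, ha⟩
  have hpos : 0 < ‖fderiv ℝ γ (t, s) (0, 1)‖ := norm_pos_iff.2 (himm _)
  have hsum : a • fderiv ℝ γ (t, s) (0, 1) =
      contactField H t (γ (t, s)) - fderiv ℝ γ (t, s) (1, 0) := by
    rw [ha, ← map_sub, ← map_smul]
    simp
  have hle : |a| * ‖fderiv ℝ γ (t, s) (0, 1)‖ ≤ M + B := by
    rw [← Real.norm_eq_abs, ← norm_smul, hsum]
    exact (norm_sub_le _ _).trans (add_le_add (hM _ _) (hB t ht s))
  have hDs := hD t ht s
  rw [norm_inv, norm_norm] at hDs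
  calc |a| = |a| * ‖fderiv ℝ γ (t, s) (0, 1)‖ * ‖fderiv ℝ γ (t, s) (0, 1)‖⁻¹ := by
        field_simp
    _ ≤ (M + B) * D :=
        mul_le_mul hle hDs (by positivity) (le_trans (by positivity) hle)

/-- If a Legendrian isotopy ends on the jet graph of `w`, then fine almost characteristics of the
driving Hamiltonian end near height `w 0`. -/
lemma eventually_abs_final_height_sub_le {γ : ℝ × ℝ → ℝ × ℝ × ℝ} (hγ : ContDiff ℝ 2 γ)
    (hper : ∀ p, γ (p + (0, 2 * π)) = γ p + (2 * π, 0, 0))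
    (himm : ∀ p, fderiv ℝ γ p (0, 1) ≠ 0)
    (hleg : ∀ p, (fderiv ℝ γ p (0, 1)).2.2 = (γ p).2.1 * (fderiv ℝ γ p (0, 1)).1)
    {H : ℝ × ℝ × ℝ × ℝ → ℝ} (hH : IsPeriodicCompactSupport H) (hH2 : ContDiff ℝ 2 H)
    (hHγ : ∀ t ∈ Icc (0 : ℝ) 1, ∀ s, H (t, γ (t, s)) = isotopyHamiltonian γ (t, s))
    {u : ℝ → ℝ} {Cu : ℝ} (hCu : ∀ x, |deriv u x| ≤ Cu)
    (hγ0 : ∀ s, γ (0, s) = (s, deriv u s, u s)) {w : ℝ → ℝ} (hw : Continuous w)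
    (hγ1 : ∀ s, ∃ x, γ (1, s) = (x, deriv w x, w x)) {ε : ℝ} (hε : 0 < ε) :
    ∀ᶠ N : ℕ in atTop, ∀ x q z, IsAlmostCharacteristic u
      (fun k p => 1 / N * H (k / N, p)) N ((1 / N : ℝ) ^ 2) x q z → |z N - w 0| < ε := by
  obtain ⟨M, L, hL0, hMx, -, hMz, hMyz, hM, hL⟩ := hH.exists_contactField_bounds hH2
  have hdiff : ∀ t, Differentiable ℝ (fun p => H (t, p)) := fun t =>
    (hH2.differentiable two_ne_zero).comp (by fun_prop)
  obtain ⟨Ca, hCa⟩ := exists_bound_contactField_eq_fderiv hγ hper himm hleg hdiff hM hHγ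
  have hd1 : ContDiff ℝ 1 (fderiv ℝ γ) := hγ.fderiv_right (by norm_num)
  obtain ⟨C₂, hC₂⟩ := exists_norm_le_of_periodic_snd (f := fderiv ℝ (fderiv ℝ γ))
    (hd1.continuous_fderiv one_ne_zero) two_pi_pos (fun t s => by
      simpa using fderiv_add_eq_of_equivariant (f := fderiv ℝ γ) (v := (0, 2 * π)) (w := 0)
        (fun p => by rw [fderiv_add_eq_of_equivariant hper, add_zero]) (t, s))
  obtain ⟨C, hC⟩ := exists_dist_final_curve_le hdiff hMx hMz hMyz hL hL0 hCu hγ hγ0 hCa hC₂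
  obtain ⟨η, hη, hwη⟩ := Metric.continuous_iff.1 hw 0 (ε / 2) (by positivity)
  have hCN : ∀ᶠ N : ℕ in atTop, C / N < min η (ε / 2) :=
    (tendsto_const_div_atTop_nhds_zero_nat C).eventually_lt_const (by positivity)
  have hMN : ∀ᶠ N : ℕ in atTop, M / N < 1 / 2 :=
    (tendsto_const_div_atTop_nhds_zero_nat M).eventually_lt_const (by positivity)
  filter_upwards [hCN, hMN, eventually_gt_atTop 0] with N hCN hMN hN x q z h
  obtain ⟨s, hs⟩ := hC N hN hMN.le _ le_rfl x q z h
  obtain ⟨x₁, hx₁⟩ := hγ1 s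
  rw [hx₁] at hs
  have h1 : |0 - x₁| ≤ C / N := (le_max_left _ _).trans hs
  have h2 : |z N - w x₁| ≤ C / N := ((le_max_right _ _).trans (le_max_right _ _)).trans hs
  have h3 : |w x₁ - w 0| < ε / 2 := by
    apply hwη
    rw [dist_comm, Real.dist_eq]
    exact h1.trans_lt (hCN.trans_le (min_le_left _ _))
  have h4 := h2.trans_lt (hCN.trans_le (min_le_right _ _))
  have := abs_sub_le (z N) (w x₁) (w 0)
  linarith

end Endpoints

section LegendrianIsotopy

open Set Filter Topology

/-- A pair of disjoint Legendrian isotopies starting at the jet graphs of `u ≤ w` cannot end at jet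
graphs of functions in the opposite strict order. -/
theorem le_of_legendrian_isotopy {γ : Fin 2 → ℝ × ℝ → ℝ × ℝ × ℝ}
    (hγ : ∀ i, ContDiff ℝ 3 (γ i)) (hknot : ∀ i t, LegendrianKnot fun s => γ i (t, s))
    (hdisj : ∀ t s s', γ 0 (t, s) ≠ γ 1 (t, s')) {u w : Fin 2 → ℝ → ℝ}
    (hu : ∀ i, ContDiff ℝ 2 (u i)) (huper : ∀ i x, u i (x + 2 * π) = u i x)
    (hu01 : ∀ x, u 0 x ≤ u 1 x) (hγ0 : ∀ i s, γ i (0, s) = (s, deriv (u i) s, u i s))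
    (hw : ∀ i, Continuous (w i)) (hγ1 : ∀ i s, ∃ x, γ i (1, s) = (x, deriv (w i) x, w i x)) :
    w 0 0 ≤ w 1 0 := by
  have hγs : ∀ i t s, HasDerivAt (fun s => γ i (t, s)) (fderiv ℝ (γ i) (t, s) (0, 1)) s :=
    fun i t s => ((hγ i).differentiable (by norm_num) (t, s)).hasFDerivAt.comp_hasDerivAt s
      ((hasDerivAt_const s t).prodMk (hasDerivAt_id s))
  have hper : ∀ i t s, γ i (t, s + 2 * π) = γ i (t, s) + (2 * π, 0, 0) := fun i t s =>
    (hknot i t).1.1.2 s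
  have hper' : ∀ i p, γ i (p + (0, 2 * π)) = γ i p + (2 * π, 0, 0) := by
    rintro i ⟨t, s⟩
    rw [← hper]
    simp
  have himm : ∀ i p, fderiv ℝ (γ i) p (0, 1) ≠ 0 := by
    rintro i ⟨t, s⟩
    rw [← (hγs i t s).deriv]
    exact (hknot i t).1.2.1 s
  have hleg : ∀ i p, (fderiv ℝ (γ i) p (0, 1)).2.2 =
      (γ i p).2.1 * (fderiv ℝ (γ i) p (0, 1)).1 := by
    rintro i ⟨t, s⟩
    rw [← (hγs i t s).triple_last.deriv, ← (hγs i t s).triple_fst.deriv]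
    exact (hknot i t).2 s
  have hinj : ∀ i j t s s', γ i (t, s) = γ j (t, s') → i = j ∧ ∃ k : ℤ, s - s' = 2 * π * k := by
    intro i j t s s' h
    have hij : i = j := by
      fin_cases i <;> fin_cases j
      · rfl
      · exact (hdisj t s s' h).elim
      · exact (hdisj t s' s h.symm).elim
      · rfl
    subst hij
    exact ⟨rfl, (hknot i t).1.2.2 s s' h⟩
  obtain ⟨H, hH2, hHper, hHsupp, hHγ⟩ := exists_hamiltonian_of_isotopies hγ hper himm hinj
  have hH : IsPeriodicCompactSupport H := ⟨hHper, hHsupp⟩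
  obtain ⟨M, L, -, hMx, hMy, hMz, hMyz, -, -⟩ := hH.exists_contactField_bounds hH2
  choose C hC using fun i => exists_abs_deriv_le_of_periodic ((hu i).of_le (by norm_num)) (huper i)
  by_contra! hlt
  have hend : ∀ i, ∀ᶠ N : ℕ in atTop, ∀ x q z, IsAlmostCharacteristic (u i)
      (fun k p => 1 / N * H (k / N, p)) N ((1 / N : ℝ) ^ 2) x q z →
        |z N - w i 0| < (w 0 0 - w 1 0) / 2 := fun i =>
    eventually_abs_final_height_sub_le ((hγ i).of_le (by norm_num)) (hper' i) (himm i) (hleg i) hH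
      hH2 (hHγ i) (hC i) (hγ0 i) (hw i) (hγ1 i) (by linarith)
  have hMN : ∀ᶠ N : ℕ in atTop, M / N < 1 / 2 :=
    (tendsto_const_div_atTop_nhds_zero_nat M).eventually_lt_const (by positivity)
  obtain ⟨N, hN0, hN1, hMN, hN⟩ :=
    ((hend 0).and ((hend 1).and (hMN.and (eventually_gt_atTop 0)))).exists
  have hN' : (0 : ℝ) < N := by exact_mod_cast hN
  have hslice : ∀ t : ℝ, ContDiff ℝ 2 fun p => H (t, p) := fun t => hH2.comp (by fun_prop)
  have hscale : ∀ (k : ℕ) (p v : ℝ × ℝ × ℝ), fderiv ℝ (fun p => 1 / N * H (k / N, p)) p v =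
      1 / N * fderiv ℝ (fun p => H (k / N, p)) p v := by
    intro k p v
    rw [fderiv_const_mul ((hslice _).differentiable two_ne_zero p)]
    rfl
  have hsmall : ∀ {r : ℝ}, |r| ≤ M → |1 / N * r| ≤ 1 / 2 := by
    intro r hr
    rw [abs_mul, abs_of_pos (by positivity), one_div_mul_eq_div]
    exact (div_le_div_of_nonneg_right hr hN'.le).trans hMN.le
  obtain ⟨x, q, z, x', q', z', h, h', hle⟩ := exists_isAlmostCharacteristic_le (hu 0) (hu 1) hu01
    (Cu := max (C 0) (C 1)) (C := 1 / 2) (F := fun k p => 1 / N * H (k / N, p))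
    (fun x => (hC 0 x).trans (le_max_left _ _)) (fun x => (hC 1 x).trans (le_max_right _ _))
    (fun k => contDiff_const.mul (hslice _))
    (fun k p => by rw [partialX, hscale]; exact hsmall (hMx _ p))
    (fun k p => by rw [partialY, hscale]; exact hsmall (hMy _ p))
    (fun k p => by rw [partialZ, hscale, mul_left_comm]; exact hsmall (hMyz _ p))
    (fun k p => by rw [partialZ, hscale]; exact hsmall (hMz _ p)) N
    (δ := (1 / N : ℝ) ^ 2) (by positivity)
  have h0 := (abs_lt.1 (hN0 x q z h)).1
  have h1 := (abs_lt.1 (hN1 x' q' z' h')).2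
  linarith

end LegendrianIsotopy

/-- for smooth 2π-periodic `g < h`, there is NO Legendrian isotopy of
ordered Legendrian links from `(Λ_g, Λ_h)` to `(Λ_h, Λ_g)`. -/
theorem no_legendrian_swap_of_jet_graphs
    (g h : ℝ → ℝ) (hg : ContDiff ℝ (⊤ : ℕ∞) g) (hh : ContDiff ℝ (⊤ : ℕ∞) h)
    (hgper : ∀ x, g (x + 2 * π) = g x) (hhper : ∀ x, h (x + 2 * π) = h x)
    (hlt : ∀ x, g x < h x) :
    ¬ ∃ H₀ H₁ : ℝ × ℝ → ℝ × ℝ × ℝ,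
      ContDiff ℝ (⊤ : ℕ∞) H₀ ∧ ContDiff ℝ (⊤ : ℕ∞) H₁ ∧
      (∀ t ∈ Set.Icc (0 : ℝ) 1,
        OrderedLegendrianLink (fun x => H₀ (t, x)) (fun x => H₁ (t, x))) ∧
      (fun x => H₀ (0, x)) = (fun x => (x, deriv g x, g x)) ∧
      (fun x => H₁ (0, x)) = (fun x => (x, deriv h x, h x)) ∧
      Set.range (fun x => H₀ (1, x)) = Set.range (fun x => (x, deriv h x, h x)) ∧
      Set.range (fun x => H₁ (1, x)) = Set.range (fun x => (x, deriv g x, g x)) := by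
  rintro ⟨H₀, H₁, hH₀, hH₁, hlink, h₀0, h₁0, h₀1, h₁1⟩
  have hmem : ∀ t, smoothTransition t ∈ Set.Icc (0 : ℝ) 1 := fun t =>
    ⟨smoothTransition.nonneg t, smoothTransition.le_one t⟩
  have hreparam : ContDiff ℝ 3 fun p : ℝ × ℝ => (smoothTransition p.1, p.2) :=
    ((smoothTransition.contDiff (n := 3)).comp contDiff_fst).prodMk contDiff_snd
  have h3 : (3 : WithTop ℕ∞) ≤ (⊤ : ℕ∞) := WithTop.coe_le_coe.2 (le_top (a := (3 : ℕ∞)))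
  have h2 : (2 : WithTop ℕ∞) ≤ (⊤ : ℕ∞) := WithTop.coe_le_coe.2 (le_top (a := (2 : ℕ∞)))
  have hle := le_of_legendrian_isotopy
    (γ := ![fun p => H₀ (smoothTransition p.1, p.2), fun p => H₁ (smoothTransition p.1, p.2)])
    (u := ![g, h]) (w := ![h, g])
    (Fin.forall_fin_two.2 ⟨(hH₀.of_le h3).comp hreparam, (hH₁.of_le h3).comp hreparam⟩)
    (Fin.forall_fin_two.2 ⟨fun t => (hlink _ (hmem t)).1, fun t => (hlink _ (hmem t)).2.1⟩)
    (fun t s s' => Set.disjoint_range_iff.1 (hlink _ (hmem t)).2.2 s s')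
    (Fin.forall_fin_two.2 ⟨hg.of_le h2, hh.of_le h2⟩)
    (Fin.forall_fin_two.2 ⟨hgper, hhper⟩) (fun x => (hlt x).le)
    (Fin.forall_fin_two.2
      ⟨fun s => by simpa using congrFun h₀0 s, fun s => by simpa using congrFun h₁0 s⟩)
    (Fin.forall_fin_two.2 ⟨hh.continuous, hg.continuous⟩)
    (Fin.forall_fin_two.2 ⟨fun s => ?_, fun s => ?_⟩)
  · exact (hlt 0).not_ge hle
  · obtain ⟨x, hx⟩ := h₀1.subset ⟨s, rfl⟩
    exact ⟨x, by simpa using hx.symm⟩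
  · obtain ⟨x, hx⟩ := h₁1.subset ⟨s, rfl⟩
    exact ⟨x, by simpa using hx.symm⟩
end

section
/- (The Traynor phenomenon disappears after stabilisation.) There exists an ordered Legendrian link (L₀, L₁) with the following two properties. (1) (L₀,L₁) is topologically isotopic to (Λ₀, Λ₁), where Λ₀(x) = (x,0,0) and Λ₁(x) = (x,0,1): there are smooth maps G⁰, G¹ : ℝ × ℝ → ℝ³ such that for each t ∈ [0,1] the maps G⁰(t,·), G¹(t,·) are embedded spinning loops with disjoint images, (G⁰(0,·), G¹(0,·)) = (L₀, L₁), and the images of G⁰(1,·), G¹(1,·) are {(x,0,0) : x ∈ ℝ} and {(x,0,1) : x ∈ ℝ} respectively. (2) The two components of (L₀,L₁) can be permuted by a Legendrian isotopy: there are smooth maps H⁰, H¹ : ℝ × ℝ → ℝ³ such that for each t ∈ [0,1] the pair (H⁰(t,·), H¹(t,·)) is an ordered Legendrian link, (H⁰(0,·), H¹(0,·)) = (L₀, L₁), the image of H⁰(1,·) equals the image of L₁, and the image of H¹(1,·) equals the image of L₀. -/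
open Real

/-- A trochoid-shaped spinning loop. For `A = 4` it is Legendrian: scaling `y, z` by `B` and
translating `z` by `C` both preserve `ker (dz - y dx)`. -/
noncomputable def trochoid (A B C s : ℝ) : ℝ × ℝ × ℝ :=
  (s - A * sin s, B * (cos s + 2), -B * sin s * (7 + 2 * cos s) + C)

theorem contDiff_trochoid_comp {E : Type*} [NormedAddCommGroup E] [NormedSpace ℝ E]
    {A B C s : E → ℝ} (hA : ContDiff ℝ (⊤ : ℕ∞) A) (hB : ContDiff ℝ (⊤ : ℕ∞) B)
    (hC : ContDiff ℝ (⊤ : ℕ∞) C) (hs : ContDiff ℝ (⊤ : ℕ∞) s) :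
    ContDiff ℝ (⊤ : ℕ∞) fun p => trochoid (A p) (B p) (C p) (s p) := by
  unfold trochoid
  fun_prop

theorem hasDerivAt_trochoid_fst (A s : ℝ) :
    HasDerivAt (fun s => s - A * sin s) (1 - A * cos s) s :=
  (hasDerivAt_id s).sub ((hasDerivAt_sin s).const_mul A)

theorem hasDerivAt_trochoid_snd (B s : ℝ) :
    HasDerivAt (fun s => B * (cos s + 2)) (-B * sin s) s :=
  (((hasDerivAt_cos s).add_const 2).const_mul B).congr_deriv (by ring)

theorem hasDerivAt_trochoid_trd (B C s : ℝ) :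
    HasDerivAt (fun s => -B * sin s * (7 + 2 * cos s) + C)
      (B * (cos s + 2) * (1 - 4 * cos s)) s := by
  refine ((((hasDerivAt_sin s).const_mul (-B)).mul
    (((hasDerivAt_cos s).const_mul 2).const_add 7)).add_const C).congr_deriv ?_
  linear_combination 2 * B * sin_sq_add_cos_sq s

theorem embeddedSpinningLoop_trochoid {A B : ℝ} (h : B ≠ 0 ∨ A = 0) (C : ℝ) :
    EmbeddedSpinningLoop (trochoid A B C) := by
  refine ⟨⟨contDiff_trochoid_comp contDiff_const contDiff_const contDiff_const contDiff_id,
    fun s => ?_⟩, fun s hs => ?_, fun s s' hss => ?_⟩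
  · simp only [trochoid, sin_add_two_pi, cos_add_two_pi, Prod.mk_add_mk, add_zero, Prod.mk.injEq,
      and_true]
    ring
  · have hd : HasDerivAt (trochoid A B C) _ s :=
      (hasDerivAt_trochoid_fst A s).prodMk
        ((hasDerivAt_trochoid_snd B s).prodMk (hasDerivAt_trochoid_trd B C s))
    rw [hd.deriv] at hs
    simp only [Prod.mk_eq_zero] at hs
    obtain ⟨hx, hy, hz⟩ := hs
    rcases h with hB | rfl
    · have hsin : sin s = 0 := by simpa [hB] using hy
      have hcos : cos s ^ 2 = 1 := by nlinarith [sin_sq_add_cos_sq s]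
      have hz' : (cos s + 2) * (1 - 4 * cos s) = 0 := by
        simpa [hB, mul_assoc] using hz
      nlinarith
    · simp at hx
  · simp only [trochoid, Prod.mk.injEq] at hss
    obtain ⟨hx, hy, hz⟩ := hss
    rcases h with hB | rfl
    · have hcos : cos s = cos s' := by simpa [hB] using hy
      have hsin : sin s = sin s' := by
        have hne : -B * (7 + 2 * cos s') ≠ 0 :=
          mul_ne_zero (neg_ne_zero.mpr hB) (by linarith [neg_one_le_cos s'])
        rw [hcos] at hz
        exact mul_right_cancel₀ hne (by linear_combination hz)
      exact Real.Angle.angle_eq_iff_two_pi_dvd_sub.mp (Real.Angle.cos_sin_inj hcos hsin)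
    · exact ⟨0, by simp at hx ⊢; linarith⟩

theorem legendrianKnot_trochoid {B : ℝ} (hB : B ≠ 0) (C : ℝ) :
    LegendrianKnot (trochoid 4 B C) := by
  refine ⟨embeddedSpinningLoop_trochoid (Or.inl hB) C, fun s => ?_⟩
  simp only [trochoid]
  rw [(hasDerivAt_trochoid_trd B C s).deriv, (hasDerivAt_trochoid_fst 4 s).deriv]

theorem abs_sin_mul_seven_add_two_mul_cos_le (s : ℝ) : |sin s * (7 + 2 * cos s)| ≤ 9 := by
  rw [abs_mul]
  calc |sin s| * |7 + 2 * cos s| ≤ 1 * 9 := by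
        gcongr
        · exact abs_sin_le_one s
        · rw [abs_le]
          constructor <;> linarith [neg_one_le_cos s, cos_le_one s]
    _ = 9 := one_mul 9

theorem disjoint_range_of_forall_ne {α β : Type*} {f g : α → β} (h : ∀ x y, f x ≠ g y) :
    Disjoint (Set.range f) (Set.range g) := by
  rw [Set.disjoint_left]
  rintro _ ⟨x, rfl⟩ ⟨y, hy⟩
  exact h x y hy.symm

/-- Two trochoids with sufficiently different heights are disjoint. -/
theorem disjoint_trochoid_of_height {A A' B B' C C' : ℝ} (hB : 0 ≤ B) (hB' : 0 ≤ B')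
    (h : 9 * (B + B') < C' - C) :
    Disjoint (Set.range (trochoid A B C)) (Set.range (trochoid A' B' C')) := by
  refine disjoint_range_of_forall_ne fun s s' hss => ?_
  simp only [trochoid, Prod.mk.injEq] at hss
  have h₁ := abs_le.mp (abs_sin_mul_seven_add_two_mul_cos_le s)
  have h₂ := abs_le.mp (abs_sin_mul_seven_add_two_mul_cos_le s')
  nlinarith [hss.2.2]

/-- Two trochoids with sufficiently different scales are disjoint, since `y > 0` on each. -/
theorem disjoint_trochoid_of_scale {A A' B B' C C' : ℝ} (hB : 0 ≤ B) (h : 3 * B < B') :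
    Disjoint (Set.range (trochoid A B C)) (Set.range (trochoid A' B' C')) := by
  refine disjoint_range_of_forall_ne fun s s' hss => ?_
  simp only [trochoid, Prod.mk.injEq] at hss
  nlinarith [hss.2.1, neg_one_le_cos s', cos_le_one s]

/-- As `(cos θ, sin θ)` traverses the upper half circle the two trochoids exchange their heights,
and they differ in scale while their heights are close. -/
theorem disjoint_trochoid_exchange {θ : ℝ} (hθ : 0 ≤ sin θ) :
    Disjoint (Set.range (trochoid 4 1 (-(36 * cos θ))))
      (Set.range (trochoid 4 (1 + 4 * sin θ) (36 * cos θ))) := by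
  rcases lt_or_ge (1 / 2) (sin θ) with h | h
  · exact disjoint_trochoid_of_scale zero_le_one (by linarith)
  · have hcos : 1 / 2 < |cos θ| := by
      by_contra! hc
      nlinarith [sin_sq_add_cos_sq θ, sq_abs (cos θ), abs_nonneg (cos θ)]
    rcases lt_abs.mp hcos with hc | hc
    · exact disjoint_trochoid_of_height zero_le_one (by linarith) (by linarith)
    · exact (disjoint_trochoid_of_height (by linarith) zero_le_one (by linarith)).symm

/-- there exists an ordered Legendrian link `(L₀, L₁)` that is
topologically isotopic (as an ordered link) to `(Λ₀, Λ₁)`, where `Λ₀(x) = (x,0,0)`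
and `Λ₁(x) = (x,0,1)`, and whose two components can be permuted by a Legendrian
isotopy of ordered Legendrian links. -/
theorem traynor_phenomenon_disappears_after_stabilisation :
    ∃ L₀ L₁ : ℝ → ℝ × ℝ × ℝ,
      OrderedLegendrianLink L₀ L₁ ∧
      -- (1) (L₀, L₁) is topologically isotopic to (Λ₀, Λ₁)
      (∃ G₀ G₁ : ℝ × ℝ → ℝ × ℝ × ℝ,
        ContDiff ℝ (⊤ : ℕ∞) G₀ ∧ ContDiff ℝ (⊤ : ℕ∞) G₁ ∧
        (∀ t ∈ Set.Icc (0 : ℝ) 1,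
          EmbeddedSpinningLoop (fun x => G₀ (t, x)) ∧
          EmbeddedSpinningLoop (fun x => G₁ (t, x)) ∧
          Disjoint (Set.range fun x => G₀ (t, x)) (Set.range fun x => G₁ (t, x))) ∧
        (fun x => G₀ (0, x)) = L₀ ∧ (fun x => G₁ (0, x)) = L₁ ∧
        Set.range (fun x => G₀ (1, x)) = {p : ℝ × ℝ × ℝ | ∃ x : ℝ, p = (x, 0, 0)} ∧
        Set.range (fun x => G₁ (1, x)) = {p : ℝ × ℝ × ℝ | ∃ x : ℝ, p = (x, 0, 1)}) ∧
      -- (2) the two components can be permuted by a Legendrian isotopy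
      (∃ H₀ H₁ : ℝ × ℝ → ℝ × ℝ × ℝ,
        ContDiff ℝ (⊤ : ℕ∞) H₀ ∧ ContDiff ℝ (⊤ : ℕ∞) H₁ ∧
        (∀ t ∈ Set.Icc (0 : ℝ) 1,
          OrderedLegendrianLink (fun x => H₀ (t, x)) (fun x => H₁ (t, x))) ∧
        (fun x => H₀ (0, x)) = L₀ ∧ (fun x => H₁ (0, x)) = L₁ ∧
        Set.range (fun x => H₀ (1, x)) = Set.range L₁ ∧
        Set.range (fun x => H₁ (1, x)) = Set.range L₀) := by
  refine ⟨trochoid 4 1 (-36), trochoid 4 1 36,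
    ⟨legendrianKnot_trochoid one_ne_zero _, legendrianKnot_trochoid one_ne_zero _,
      disjoint_trochoid_of_height zero_le_one zero_le_one (by norm_num)⟩,
    ⟨fun p => trochoid (4 * (1 - p.1)) (1 - p.1) (-36 * (1 - p.1)) p.2,
      fun p => trochoid (4 * (1 - p.1)) (1 - p.1) (36 * (1 - p.1) + p.1) p.2,
      contDiff_trochoid_comp (by fun_prop) (by fun_prop) (by fun_prop) (by fun_prop),
      contDiff_trochoid_comp (by fun_prop) (by fun_prop) (by fun_prop) (by fun_prop),
      fun t ht => ?_, ?_, ?_, ?_, ?_⟩,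
    ⟨fun p => trochoid 4 1 (-(36 * cos (π * p.1))) p.2,
      fun p => trochoid 4 (1 + 4 * sin (π * p.1)) (36 * cos (π * p.1)) p.2,
      contDiff_trochoid_comp (by fun_prop) (by fun_prop) (by fun_prop) (by fun_prop),
      contDiff_trochoid_comp (by fun_prop) (by fun_prop) (by fun_prop) (by fun_prop),
      fun t ht => ?_, ?_, ?_, ?_, ?_⟩⟩
  · have h : 1 - t ≠ 0 ∨ 4 * (1 - t) = 0 := by
      by_cases h : 1 - t = 0 <;> simp [h]
    have ht₁ : 0 ≤ 1 - t := sub_nonneg.mpr ht.2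
    dsimp only
    exact ⟨embeddedSpinningLoop_trochoid h _, embeddedSpinningLoop_trochoid h _,
      disjoint_trochoid_of_height ht₁ ht₁ (by linarith)⟩
  · simp
  · simp
  · ext p
    simp [trochoid, eq_comm]
  · ext p
    simp [trochoid, eq_comm]
  · have hsin : 0 ≤ sin (π * t) :=
      sin_nonneg_of_nonneg_of_le_pi (mul_nonneg pi_pos.le ht.1)
        (mul_le_of_le_one_right pi_pos.le ht.2)
    have hne : 1 + 4 * sin (π * t) ≠ 0 := by positivity
    dsimp only
    exact ⟨legendrianKnot_trochoid one_ne_zero _, legendrianKnot_trochoid hne _,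
      disjoint_trochoid_exchange hsin⟩
  all_goals simp
end
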